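/- arXiv:math/0012181 — 4 statements merged into one kernel-verified Lean document; each statement's English description precedes it below -/
import Mathlib

section
/- Let φ be a travelling-wave profile with speed c and limits E^±, and suppose that every root μ ∈ ℂ of the characteristic equation det(A μ² + (c·I + C⁺) μ + B⁺) = 0 has nonzero real part, and likewise every root of det(A μ² + (c·I + C⁻) μ + B⁻) = 0 has nonzero real part. Then there exist constants K > 0 and γ > 0 such that |φ(x) − E⁺| + |φ'(x)| ≤ K e^{−γ x} for all x ≥ 0 and |φ(x) − E⁻| + |φ'(x)| ≤ K e^{γ x} for all x ≤ 0. -/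
open Matrix Filter Topology

/-- Jacobian of f with respect to its first argument. -/
noncomputable def Du {N : ℕ} (f : (Fin N → ℝ) → (Fin N → ℝ) → Fin N → ℝ)
    (u p : Fin N → ℝ) : Matrix (Fin N) (Fin N) ℝ :=
  fun i j => fderiv ℝ (fun u' => f u' p i) u (Pi.single j 1)

/-- Jacobian of f with respect to its second argument. -/
noncomputable def Dp {N : ℕ} (f : (Fin N → ℝ) → (Fin N → ℝ) → Fin N → ℝ)
    (u p : Fin N → ℝ) : Matrix (Fin N) (Fin N) ℝ :=
  fun i j => fderiv ℝ (fun p' => f u p' i) p (Pi.single j 1)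

theorem exists_bilinear_of_hyperbolic (n : ℕ) : ∀ (E : Type) [NormedAddCommGroup E] [NormedSpace ℂ E]
    [NormedSpace ℝ E] [IsScalarTower ℝ ℂ E] [FiniteDimensional ℂ E] (M : E →ₗ[ℂ] E),
    Module.finrank ℂ E = n → (∀ μ : ℂ, Module.End.HasEigenvalue M μ → μ.re ≠ 0) →
    ∃ B : E →L[ℝ] E →L[ℝ] ℝ, (∀ v w, B v w = B w v) ∧
      ∃ δ > 0, ∀ v, δ * ‖v‖ ^ 2 ≤ B v (M v) := by
  induction n with
  | zero =>
    intro E _ _ _ _ _ M hn _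
    have : Subsingleton E := Module.finrank_zero_iff.1 hn
    refine ⟨0, fun _ _ => rfl, 1, one_pos, fun v => ?_⟩
    simp [Subsingleton.elim v 0]
  | succ n ih =>
    intro E _ _ _ _ _ M hn hM
    have : Nontrivial E := Module.nontrivial_of_finrank_pos (R := ℂ) (by omega)
    obtain ⟨l, hl⟩ := Module.End.exists_eigenvalue M
    have hrange : LinearMap.range (M - l • (1 : E →ₗ[ℂ] E)) < ⊤ := by
      rw [lt_top_iff_ne_top]
      intro h
      have hinj := LinearMap.injective_iff_surjective.2 (LinearMap.range_eq_top.1 h)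
      obtain ⟨v, hv⟩ := hl.exists_hasEigenvector
      apply hv.2
      apply hinj
      simp [hv.apply_eq_smul]
    obtain ⟨ℓ, hℓ0, hℓ⟩ := Submodule.exists_le_ker_of_lt_top _ hrange
    have hℓM (v : E) : ℓ (M v) = l * ℓ v := by
      have := hℓ (LinearMap.mem_range_self (M - l • (1 : E →ₗ[ℂ] E)) v)
      simpa [sub_eq_zero] using this
    obtain ⟨u, hu⟩ : ∃ u, ℓ u = 1 := by
      obtain ⟨w, hw⟩ : ∃ w, ℓ w ≠ 0 := by
        by_contra! h
        exact hℓ0 (LinearMap.ext h)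
      exact ⟨(ℓ w)⁻¹ • w, by simp [hw]⟩
    have hMW (v : E) (hv : v ∈ LinearMap.ker ℓ) : M v ∈ LinearMap.ker ℓ := by
      rw [LinearMap.mem_ker] at *
      rw [hℓM, hv, mul_zero]
    let W := LinearMap.ker ℓ
    let P₀ : E →ₗ[ℂ] W := (LinearMap.id - ℓ.smulRight u).codRestrict W
      (fun v => by simp [W, hu])
    let P : E →L[ℂ] W := LinearMap.toContinuousLinearMap P₀
    let L : E →L[ℂ] ℂ := LinearMap.toContinuousLinearMap ℓ
    have hfin : Module.finrank ℂ W = n := by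
      have h1 := LinearMap.finrank_range_add_finrank_ker ℓ
      have h2 : LinearMap.range ℓ = ⊤ := LinearMap.range_eq_top.2 fun s => ⟨s • u, by simp [hu]⟩
      rw [h2, finrank_top, hn, Module.finrank_self] at h1
      change Module.finrank ℂ (LinearMap.ker ℓ) = n
      omega
    obtain ⟨B, hBs, δ, hδ, hB⟩ := ih W (M.restrict hMW) hfin (by
      intro μ hμ
      obtain ⟨v, hv⟩ := hμ.exists_hasEigenvector
      refine hM μ (Module.End.hasEigenvalue_of_hasEigenvector (x := (v : E)) ?_)
      rw [Module.End.hasEigenvector_iff, Module.End.mem_eigenspace_iff]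
      exact ⟨congrArg Subtype.val hv.apply_eq_smul, fun h => hv.2 (Subtype.ext h)⟩)
    have hre := hM l hl
    set r : W := P (M u)
    have hPM (v : E) : P (M v) = M.restrict hMW (P v) + L v • r := by
      apply Subtype.ext
      change M v - ℓ (M v) • u = M (v - ℓ v • u) + ℓ v • (M u - ℓ (M u) • u)
      rw [hℓM, hℓM, hu, map_sub, map_smul, smul_sub, smul_smul]
      rw [mul_one, mul_comm l]
      abel
    obtain ⟨C, hC0, hC⟩ : ∃ C > 0, ∀ (w : W) (s : ℂ), ‖B w (s • r)‖ ≤ C * (‖w‖ * ‖s‖) := by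
      refine ⟨‖B‖ * ‖r‖ + 1, by positivity, fun w s => ?_⟩
      calc ‖B w (s • r)‖ ≤ ‖B‖ * ‖w‖ * ‖s • r‖ := B.le_opNorm₂ _ _
        _ = (‖B‖ * ‖r‖) * (‖w‖ * ‖s‖) := by rw [norm_smul]; ring
        _ ≤ _ := by gcongr; linarith
    let K : ℝ := (C ^ 2 / (2 * δ) + δ / 2) / l.re
    have hKl : K * l.re = C ^ 2 / (2 * δ) + δ / 2 := div_mul_cancel₀ _ hre
    let B₁ : E →L[ℝ] E →L[ℝ] ℝ := B.bilinearComp (P.restrictScalars ℝ) (P.restrictScalars ℝ)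
    let B₂ : E →L[ℝ] E →L[ℝ] ℝ :=
      (innerSL ℝ : ℂ →L[ℝ] ℂ →L[ℝ] ℝ).bilinearComp (L.restrictScalars ℝ) (L.restrictScalars ℝ)
    have hval (v w : E) : (B₁ + K • B₂) v w = B (P v) (P w) + K * inner ℝ (L v) (L w) := rfl
    refine ⟨B₁ + K • B₂, fun v w => ?_, δ / 4 / (1 + ‖u‖) ^ 2, by positivity, fun v => ?_⟩
    · rw [hval, hval, hBs, real_inner_comm]
    · rw [hval, hPM, map_add]
      have h1 := hB (P v)
      have h2 := hC (P v) (L v)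
      rw [Real.norm_eq_abs, abs_le] at h2
      have h3 : K * inner ℝ (L v) (L (M v)) = (C ^ 2 / (2 * δ) + δ / 2) * ‖L v‖ ^ 2 := by
        have : L (M v) = l * L v := hℓM v
        rw [this, Complex.inner, ← hKl, mul_assoc, ← Complex.normSq_eq_norm_sq, Complex.normSq_apply]
        simp
        ring
      have hv : ‖v‖ ≤ (1 + ‖u‖) * (‖P v‖ + ‖L v‖) := by
        have : v = (P v : E) + L v • u := by
          change v = v - ℓ v • u + ℓ v • u
          abel
        calc ‖v‖ = ‖(P v : E) + L v • u‖ := by rw [← this]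
          _ ≤ ‖P v‖ + ‖L v‖ * ‖u‖ := by
            refine (norm_add_le _ _).trans ?_
            rw [norm_smul]; rfl
          _ ≤ _ := by nlinarith [norm_nonneg (P v), norm_nonneg (L v), norm_nonneg u,
              mul_nonneg (norm_nonneg (P v)) (norm_nonneg u)]
      rw [h3]
      set a := ‖P v‖
      set b := ‖L v‖
      have h4 : δ / 4 / (1 + ‖u‖) ^ 2 * ‖v‖ ^ 2 ≤ δ / 4 * (a + b) ^ 2 := by
        rw [div_mul_eq_mul_div, div_le_iff₀ (by positivity)]
        calc δ / 4 * ‖v‖ ^ 2 ≤ δ / 4 * ((1 + ‖u‖) * (a + b)) ^ 2 := by gcongr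
          _ = _ := by ring
      have h5 : C * (a * b) ≤ δ / 2 * a ^ 2 + C ^ 2 / (2 * δ) * b ^ 2 := by
        have : δ / 2 * a ^ 2 + C ^ 2 / (2 * δ) * b ^ 2 - C * (a * b)
            = (δ * a - C * b) ^ 2 / (2 * δ) := by field_simp; ring
        have h6 : 0 ≤ (δ * a - C * b) ^ 2 / (2 * δ) := by positivity
        linarith
      nlinarith [sq_nonneg (a - b), h2.1]

theorem exponential_decay_of_lyapunov {E : Type*} [NormedAddCommGroup E] [NormedSpace ℝ E]
    (M : E →L[ℝ] E) (B Q : E →L[ℝ] E →L[ℝ] ℝ) (hBs : ∀ v w, B v w = B w v)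
    (hQs : ∀ v w, Q v w = Q w v) {δ q : ℝ} (hδ : 0 < δ) (hq : 0 < q)
    (hB : ∀ v, δ * ‖v‖ ^ 2 ≤ B v (M v)) (hQ : ∀ v, q * ‖v‖ ^ 2 ≤ Q v v)
    {z z' : ℝ → E} (hz : ∀ x, HasDerivAt z (z' x) x) (hlim : Tendsto z atTop (𝓝 0))
    (ho : (fun x => z' x - M (z x)) =o[atTop] z) :
    ∃ K > 0, ∃ γ > 0, ∀ x, 0 ≤ x → ‖z x‖ ≤ K * Real.exp (-γ * x) := by
  have hquad (T : E →L[ℝ] E →L[ℝ] ℝ) (hT : ∀ v w, T v w = T w v) (x : ℝ) :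
      HasDerivAt (fun x => T (z x) (z x)) (2 * T (z x) (z' x)) x := by
    have := (T.hasFDerivAt.comp_hasDerivAt x (hz x)).clm_apply (hz x)
    rw [hT (z' x) (z x)] at this
    rwa [two_mul]
  set ε : ℝ := δ / (2 * (‖B‖ + 1)) with hε
  have hε0 : 0 < ε := by positivity
  have hBε : ‖B‖ * ε ≤ δ / 2 := by
    rw [hε, mul_div_assoc', div_le_iff₀ (by positivity)]
    nlinarith [norm_nonneg B]
  set m : ℝ := ‖M‖ + ε
  set η : ℝ := δ / (4 * (‖Q‖ * m + 1)) with hη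
  have hm : 0 < m := by positivity
  have hη0 : 0 < η := by positivity
  have hQη : η * (‖Q‖ * m) ≤ δ / 4 := by
    rw [hη, div_mul_eq_mul_div, div_le_iff₀ (by positivity)]
    nlinarith [mul_nonneg (norm_nonneg Q) hm.le]
  obtain ⟨X₀, hX₀⟩ := eventually_atTop.1 (ho.def hε0)
  set X := max X₀ 0
  have hX (x : ℝ) (hx : X ≤ x) : ‖z' x - M (z x)‖ ≤ ε * ‖z x‖ :=
    hX₀ x ((le_max_left _ _).trans hx)
  have hz' (x : ℝ) (hx : X ≤ x) : ‖z' x‖ ≤ m * ‖z x‖ := by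
    calc ‖z' x‖ = ‖M (z x) + (z' x - M (z x))‖ := by congr 1; abel
      _ ≤ ‖M‖ * ‖z x‖ + ε * ‖z x‖ := norm_add_le_of_le (M.le_opNorm _) (hX x hx)
      _ = _ := by ring
  have hV' (x : ℝ) (hx : X ≤ x) : δ / 2 * ‖z x‖ ^ 2 ≤ B (z x) (z' x) := by
    have h1 : B (z x) (z' x) = B (z x) (M (z x)) + B (z x) (z' x - M (z x)) := by
      rw [map_sub]; ring
    have h2 : ‖B (z x) (z' x - M (z x))‖ ≤ δ / 2 * ‖z x‖ ^ 2 := by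
      calc _ ≤ ‖B‖ * ‖z x‖ * ‖z' x - M (z x)‖ := B.le_opNorm₂ _ _
        _ ≤ ‖B‖ * ‖z x‖ * (ε * ‖z x‖) := by gcongr; exact hX x hx
        _ = (‖B‖ * ε) * ‖z x‖ ^ 2 := by ring
        _ ≤ _ := by gcongr
    rw [Real.norm_eq_abs, abs_le] at h2
    linarith [hB (z x), h2.1]
  have hVmono : MonotoneOn (fun x => B (z x) (z x)) (Set.Ici X) := by
    refine monotoneOn_of_hasDerivWithinAt_nonneg (convex_Ici X)
      (fun x _ => (hquad B hBs x).continuousAt.continuousWithinAt)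
      (fun x _ => (hquad B hBs x).hasDerivWithinAt) (fun x hx => ?_)
    rw [interior_Ici] at hx
    have := hV' x (le_of_lt hx)
    have : 0 ≤ δ / 2 * ‖z x‖ ^ 2 := by positivity
    linarith
  have hVneg (x : ℝ) (hx : X ≤ x) : B (z x) (z x) ≤ 0 := by
    have ht : Tendsto (fun x => B (z x) (z x)) atTop (𝓝 0) := by
      have := (B.continuous₂.tendsto (0, 0)).comp (hlim.prodMk_nhds hlim)
      simpa [Function.comp_def] using this
    refine ge_of_tendsto ht ?_
    filter_upwards [eventually_ge_atTop x] with y hy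
    exact hVmono hx (hx.trans hy) hy
  set κ : ℝ := δ / (2 * (‖B‖ + η * ‖Q‖ + 1)) with hκ
  have hκ0 : 0 < κ := by positivity
  let U : ℝ → ℝ := fun x => -B (z x) (z x) + η * Q (z x) (z x)
  have hU (x : ℝ) : HasDerivAt U (-(2 * B (z x) (z' x)) + η * (2 * Q (z x) (z' x))) x :=
    (hquad B hBs x).neg.add ((hquad Q hQs x).const_mul η)
  have hU' (x : ℝ) (hx : X ≤ x) :
      -(2 * B (z x) (z' x)) + η * (2 * Q (z x) (z' x)) + κ * U x ≤ 0 := by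
    have h1 : Q (z x) (z' x) ≤ ‖Q‖ * m * ‖z x‖ ^ 2 := by
      calc _ ≤ ‖Q (z x) (z' x)‖ := Real.le_norm_self _
        _ ≤ ‖Q‖ * ‖z x‖ * ‖z' x‖ := Q.le_opNorm₂ _ _
        _ ≤ ‖Q‖ * ‖z x‖ * (m * ‖z x‖) := by gcongr; exact hz' x hx
        _ = _ := by ring
    have h2 : U x ≤ (‖B‖ + η * ‖Q‖ + 1) * ‖z x‖ ^ 2 := by
      have h3 : -B (z x) (z x) ≤ ‖B‖ * ‖z x‖ * ‖z x‖ :=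
        (neg_le_abs _).trans (B.le_opNorm₂ _ _)
      have h4 : Q (z x) (z x) ≤ ‖Q‖ * ‖z x‖ * ‖z x‖ :=
        (le_abs_self _).trans (Q.le_opNorm₂ _ _)
      have h5 := mul_le_mul_of_nonneg_left h4 hη0.le
      simp only [U]
      nlinarith [sq_nonneg ‖z x‖]
    have h6 : κ * U x ≤ δ / 2 * ‖z x‖ ^ 2 := by
      calc κ * U x ≤ κ * ((‖B‖ + η * ‖Q‖ + 1) * ‖z x‖ ^ 2) := by gcongr
        _ = _ := by rw [hκ]; field_simp
    have h7 := mul_le_mul_of_nonneg_left h1 hη0.le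
    have h8 := mul_le_mul_of_nonneg_right hQη (sq_nonneg ‖z x‖)
    nlinarith [hV' x hx]
  have hanti : AntitoneOn (fun x => U x * Real.exp (κ * x)) (Set.Ici X) := by
    have hd (x : ℝ) := (hU x).mul (((hasDerivAt_id x).const_mul κ).exp)
    refine antitoneOn_of_hasDerivWithinAt_nonpos (convex_Ici X)
      (fun x _ => (hd x).continuousAt.continuousWithinAt)
      (fun x _ => (hd x).hasDerivWithinAt) (fun x hx => ?_)
    rw [interior_Ici] at hx
    have := mul_nonpos_of_nonpos_of_nonneg (hU' x (le_of_lt hx)) (Real.exp_pos (κ * x)).le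
    simp only [id_eq, mul_one]
    linarith
  have hbound (x : ℝ) (hx : X ≤ x) :
      ‖z x‖ ^ 2 ≤ (U X * Real.exp (κ * X) / (η * q)) * Real.exp (-κ * x) := by
    have h1 : U x * Real.exp (κ * x) ≤ U X * Real.exp (κ * X) :=
      hanti (Set.mem_Ici.2 le_rfl) hx hx
    have h2 : η * q * ‖z x‖ ^ 2 ≤ U x := by
      have := mul_le_mul_of_nonneg_left (hQ (z x)) hη0.le
      simp only [U]
      linarith [hVneg x hx]
    have h3 : η * q * ‖z x‖ ^ 2 * Real.exp (κ * x) ≤ U X * Real.exp (κ * X) :=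
      (mul_le_mul_of_nonneg_right h2 (Real.exp_pos _).le).trans h1
    rw [neg_mul, Real.exp_neg, ← div_eq_mul_inv, le_div_iff₀ (Real.exp_pos _),
      le_div_iff₀ (by positivity)]
    linarith
  set C := U X * Real.exp (κ * X) / (η * q)
  have hcont : Continuous z := continuous_iff_continuousAt.2 fun x => (hz x).continuousAt
  obtain ⟨D, hD⟩ := isCompact_Icc.exists_bound_of_continuousOn (s := Set.Icc (0 : ℝ) X)
    hcont.continuousOn
  refine ⟨√C + |D| * Real.exp (κ / 2 * X) + 1, by positivity, κ / 2, by positivity,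
    fun x hx => ?_⟩
  have hp : 0 ≤ Real.exp (-(κ / 2) * x) := (Real.exp_pos _).le
  rcases le_total X x with h | h
  · have h1 : ‖z x‖ ≤ √C * Real.exp (-(κ / 2) * x) := by
      have h2 := Real.sqrt_le_sqrt (hbound x h)
      rw [Real.sqrt_sq (norm_nonneg _), Real.sqrt_mul' _ (Real.exp_pos _).le] at h2
      rwa [show -κ * x = (-(κ / 2) * x) + (-(κ / 2) * x) by ring, Real.exp_add,
        Real.sqrt_mul_self hp] at h2
    refine h1.trans ?_
    gcongr
    have : 0 ≤ |D| * Real.exp (κ / 2 * X) := by positivity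
    linarith
  · have h1 : ‖z x‖ ≤ |D| * Real.exp (κ / 2 * X) * Real.exp (-(κ / 2) * x) := by
      rw [mul_assoc, ← Real.exp_add]
      have h2 : 1 ≤ Real.exp (κ / 2 * X + -(κ / 2) * x) := by
        apply Real.one_le_exp
        nlinarith
      calc ‖z x‖ ≤ |D| := (hD x ⟨hx, h⟩).trans (le_abs_self D)
        _ ≤ _ := le_mul_of_one_le_right (abs_nonneg D) h2
    refine h1.trans ?_
    gcongr
    linarith [Real.sqrt_nonneg C]

theorem tendsto_zero_of_hasDerivAt_of_tendsto {E : Type*} [NormedAddCommGroup E] [NormedSpace ℝ E]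
    {g g' : ℝ → E} {a : E} (hg : ∀ x, HasDerivAt g (g' x) x) (hlim : Tendsto g atTop (𝓝 a))
    (hosc : ∀ ε > 0, ∃ h > 0, ∀ᶠ x in atTop, ∀ t ∈ Set.Icc x (x + h), ‖g' t - g' x‖ ≤ ε) :
    Tendsto g' atTop (𝓝 0) := by
  rw [Metric.tendsto_nhds]
  intro ε hε
  obtain ⟨h, hh, hev⟩ := hosc (ε / 4) (by positivity)
  have hdiff : Tendsto (fun x => g (x + h) - g x) atTop (𝓝 0) := by
    simpa using (hlim.comp (tendsto_atTop_add_const_right _ h tendsto_id)).sub hlim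
  have hsmall := (Metric.tendsto_nhds.1 hdiff) (ε / 4 * h) (by positivity)
  filter_upwards [hev, hsmall] with x hx hxs
  rw [dist_zero_right] at *
  have hd (t : ℝ) : HasDerivAt (fun t => g t - t • g' x) (g' t - g' x) t := by
    simpa using! (hg t).sub ((hasDerivAt_id t).smul_const (g' x))
  have h1 := norm_image_sub_le_of_norm_deriv_le_segment' (a := x) (b := x + h)
    (fun t _ => (hd t).hasDerivWithinAt) (fun t ht => hx t ⟨ht.1, ht.2.le⟩)
    (x + h) ⟨by linarith, le_rfl⟩
  have h2 : h • g' x = (g (x + h) - g x) -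
      (g (x + h) - (x + h) • g' x - (g x - x • g' x)) := by
    rw [add_smul]; abel
  have h3 : h * ‖g' x‖ ≤ ε / 4 * h + ε / 4 * h := by
    calc h * ‖g' x‖ = ‖h • g' x‖ := by rw [norm_smul, Real.norm_of_nonneg hh.le]
      _ ≤ _ := by
        rw [h2]
        refine norm_sub_le_of_le hxs.le (h1.trans_eq ?_)
        ring
  nlinarith

theorem exists_bilinear_of_det_ne_zero {N : ℕ} (S R : Matrix (Fin N) (Fin N) ℝ)
    (hchar : ∀ μ : ℂ, (μ ^ 2 • (1 : Matrix (Fin N) (Fin N) ℂ) + μ • R.map Complex.ofReal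
      + S.map Complex.ofReal).det = 0 → μ.re ≠ 0) :
    ∃ B Q : ((Fin N → ℝ) × (Fin N → ℝ)) →L[ℝ] ((Fin N → ℝ) × (Fin N → ℝ)) →L[ℝ] ℝ,
      (∀ v w, B v w = B w v) ∧ (∀ v w, Q v w = Q w v) ∧ ∃ δ > 0, ∃ q > 0,
        (∀ v, δ * ‖v‖ ^ 2 ≤ B v (v.2, -(S *ᵥ v.1 + R *ᵥ v.2))) ∧
        ∀ v, q * ‖v‖ ^ 2 ≤ Q v v := by
  let J₀ : (Fin N → ℝ) →L[ℝ] (Fin N → ℂ) :=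
    ContinuousLinearMap.pi fun i => Complex.ofRealCLM.comp (ContinuousLinearMap.proj i)
  have hJ₀ (u : Fin N → ℝ) : J₀ u = Complex.ofReal ∘ u := rfl
  have hJ₀n (u : Fin N → ℝ) : ‖J₀ u‖ = ‖u‖ := by
    simp [hJ₀, Pi.norm_def]
  let J := J₀.prodMap J₀
  have hJ (v : (Fin N → ℝ) × (Fin N → ℝ)) : J v = (J₀ v.1, J₀ v.2) := rfl
  have hJn (v : (Fin N → ℝ) × (Fin N → ℝ)) : ‖J v‖ = ‖v‖ := by
    rw [hJ, Prod.norm_mk, hJ₀n, hJ₀n, Prod.norm_def]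
  have hmul (T : Matrix (Fin N) (Fin N) ℝ) (u : Fin N → ℝ) :
      J₀ (T *ᵥ u) = T.map Complex.ofReal *ᵥ J₀ u :=
    funext (RingHom.map_mulVec Complex.ofRealHom T u)
  let M : ((Fin N → ℂ) × (Fin N → ℂ)) →ₗ[ℂ] ((Fin N → ℂ) × (Fin N → ℂ)) :=
    (LinearMap.snd ℂ _ _).prod (-((S.map Complex.ofReal).mulVecLin ∘ₗ LinearMap.fst ℂ _ _ +
      (R.map Complex.ofReal).mulVecLin ∘ₗ LinearMap.snd ℂ _ _))
  have hM (v : (Fin N → ℂ) × (Fin N → ℂ)) : M v =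
    (v.2, -(S.map Complex.ofReal *ᵥ v.1 + R.map Complex.ofReal *ᵥ v.2)) := rfl
  obtain ⟨B, hBs, δ, hδ, hB⟩ := exists_bilinear_of_hyperbolic _ _ M rfl (by
    intro μ hμ
    obtain ⟨v, hv⟩ := hμ.exists_hasEigenvector
    have h := hv.apply_eq_smul
    rw [hM, Prod.ext_iff] at h
    obtain ⟨h1, h2⟩ := h
    simp only [Prod.smul_fst, Prod.smul_snd] at h1 h2
    refine hchar μ (Matrix.exists_mulVec_eq_zero_iff.1 ⟨v.1, fun h0 => hv.2 ?_, ?_⟩)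
    · exact Prod.ext h0 (by rw [h1, h0, smul_zero]; rfl)
    · rw [h1, smul_smul, ← pow_two, Matrix.mulVec_smul] at h2
      rw [Matrix.add_mulVec, Matrix.add_mulVec, Matrix.smul_mulVec, Matrix.smul_mulVec,
        Matrix.one_mulVec, ← h2]
      abel)
  obtain ⟨Q, hQs, q, hq, hQ⟩ := exists_bilinear_of_hyperbolic _ _
    (1 : ((Fin N → ℂ) × (Fin N → ℂ)) →ₗ[ℂ] ((Fin N → ℂ) × (Fin N → ℂ))) rfl (by
    intro μ hμ
    obtain ⟨v, hv⟩ := hμ.exists_hasEigenvector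
    have h : (1 : ℂ) • v = μ • v := by rw [one_smul]; exact hv.apply_eq_smul
    rw [← smul_left_injective ℂ hv.2 h]
    simp)
  refine ⟨B.bilinearComp J J, Q.bilinearComp J J, fun v w => hBs _ _, fun v w => hQs _ _,
    δ, hδ, q, hq, fun v => ?_, fun v => ?_⟩
  · rw [← hJn]
    refine (hB (J v)).trans_eq ?_
    simp only [ContinuousLinearMap.bilinearComp_apply]
    congr 1
    rw [hM, hJ, hJ, map_neg, map_add, hmul, hmul]
  · rw [← hJn]
    exact hQ (J v)

theorem exponential_decay_of_hyperbolic {N : ℕ}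
    {F : (Fin N → ℝ) × (Fin N → ℝ) → Fin N → ℝ} {E : Fin N → ℝ}
    {D : ((Fin N → ℝ) × (Fin N → ℝ)) →L[ℝ] (Fin N → ℝ)} {S R : Matrix (Fin N) (Fin N) ℝ}
    {φ φ₁ φ₂ : ℝ → Fin N → ℝ} (hF : Continuous F) (hFD : HasFDerivAt F D (E, 0))
    (hD : ∀ v, D v = S *ᵥ v.1 + R *ᵥ v.2)
    (hφ : ∀ x, HasDerivAt φ (φ₁ x) x) (hφ₁ : ∀ x, HasDerivAt φ₁ (φ₂ x) x)
    (hbdd : ∃ m, ∀ x, ‖φ x‖ ≤ m ∧ ‖φ₁ x‖ ≤ m)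
    (heq : ∀ x, φ₂ x = -F (φ x, φ₁ x)) (hlim : Tendsto φ atTop (𝓝 E))
    (hchar : ∀ μ : ℂ, (μ ^ 2 • (1 : Matrix (Fin N) (Fin N) ℂ) + μ • R.map Complex.ofReal
      + S.map Complex.ofReal).det = 0 → μ.re ≠ 0) :
    ∃ K > 0, ∃ γ > 0, ∀ x, 0 ≤ x → ‖φ x - E‖ + ‖φ₁ x‖ ≤ K * Real.exp (-γ * x) := by
  obtain ⟨m, hm⟩ := hbdd
  obtain ⟨L, hL⟩ := (isCompact_closedBall (0 : (Fin N → ℝ) × (Fin N → ℝ))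
    m).exists_bound_of_continuousOn hF.continuousOn
  have hφ₂ (x : ℝ) : ‖φ₂ x‖ ≤ L := by
    rw [heq, norm_neg]
    refine hL _ ?_
    rw [mem_closedBall_zero_iff]
    exact max_le (hm x).1 (hm x).2
  have hL0 : 0 ≤ L := (norm_nonneg _).trans (hφ₂ 0)
  have hlim₁ : Tendsto φ₁ atTop (𝓝 0) := by
    refine tendsto_zero_of_hasDerivAt_of_tendsto hφ hlim fun ε hε => ?_
    refine ⟨ε / (L + 1), by positivity, Eventually.of_forall fun x t ht => ?_⟩
    refine (norm_image_sub_le_of_norm_deriv_le_segment'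
      (fun s _ => (hφ₁ s).hasDerivWithinAt) (fun s _ => hφ₂ s) t ht).trans ?_
    calc L * (t - x) ≤ L * (ε / (L + 1)) := by gcongr; linarith [ht.2]
      _ ≤ ε := by
        rw [mul_div_assoc', div_le_iff₀ (by positivity)]
        nlinarith
  have hpair : Tendsto (fun x => (φ x, φ₁ x)) atTop (𝓝 (E, 0)) := hlim.prodMk_nhds hlim₁
  have hlim₂ : Tendsto φ₂ atTop (𝓝 (-F (E, 0))) := by
    rw [funext heq]
    exact ((hF.tendsto _).comp hpair).neg
  have hFE : F (E, 0) = 0 := by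
    have h0 : Tendsto φ₂ atTop (𝓝 0) := by
      refine tendsto_zero_of_hasDerivAt_of_tendsto hφ₁ hlim₁ fun ε hε => ⟨1, one_pos, ?_⟩
      have h := Metric.tendsto_nhds.1 hlim₂ (ε / 2) (by positivity)
      obtain ⟨X, hX⟩ := eventually_atTop.1 h
      filter_upwards [eventually_ge_atTop X] with x hx t ht
      rw [← dist_eq_norm]
      have := dist_triangle_right (φ₂ t) (φ₂ x) (-F (E, 0))
      linarith [hX x hx, hX t (hx.trans ht.1)]
    exact neg_eq_zero.1 (tendsto_nhds_unique hlim₂ h0)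
  obtain ⟨B, Q, hBs, hQs, δ, hδ, q, hq, hB, hQ⟩ := exists_bilinear_of_det_ne_zero S R hchar
  let M : ((Fin N → ℝ) × (Fin N → ℝ)) →L[ℝ] ((Fin N → ℝ) × (Fin N → ℝ)) :=
    (ContinuousLinearMap.snd ℝ _ _).prod (-D)
  have hM (v : (Fin N → ℝ) × (Fin N → ℝ)) : M v = (v.2, -D v) := rfl
  obtain ⟨K, hK, γ, hγ, h⟩ := exponential_decay_of_lyapunov M B Q hBs hQs hδ hq
    (fun v => by rw [hM, hD]; exact hB v) hQ
    (z := fun x => (φ x - E, φ₁ x)) (z' := fun x => (φ₁ x, φ₂ x))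
    (fun x => ((hφ x).sub_const E).prodMk (hφ₁ x))
    (by simpa [← Prod.zero_eq_mk] using (hlim.sub_const E).prodMk_nhds hlim₁) (by
      have h1 := hFD.isLittleO.comp_tendsto hpair
      have h2 : ((fun v => v - (E, 0)) ∘ fun x => (φ x, φ₁ x)) =
          fun x => (φ x - E, φ₁ x) := by
        ext x <;> simp
      change _ =o[atTop] ((fun v => v - (E, 0)) ∘ fun x => (φ x, φ₁ x)) at h1
      rw [h2] at h1
      refine (Asymptotics.IsBigO.of_bound 1 (Eventually.of_forall fun x => ?_)).trans_isLittleO h1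
      have h3 : (φ₁ x, φ₂ x) - M (φ x - E, φ₁ x) = (0, -(F (φ x, φ₁ x) - D (φ x - E, φ₁ x))) := by
        rw [hM, heq]
        ext <;> simp
        ring
      rw [h3, one_mul, Prod.norm_mk, norm_zero, norm_neg, max_eq_right (norm_nonneg _)]
      simp only [Function.comp_apply, hFE, sub_zero, Prod.mk_sub_mk, le_refl])
  refine ⟨2 * K, by positivity, γ, hγ, fun x hx => ?_⟩
  have h1 := h x hx
  have h2 := (norm_fst_le (φ x - E, φ₁ x)).trans h1
  have h3 := (norm_snd_le (φ x - E, φ₁ x)).trans h1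
  simp only at h2 h3
  linarith

theorem fderiv_eq_Du_add_Dp {N : ℕ} {f : (Fin N → ℝ) → (Fin N → ℝ) → Fin N → ℝ}
    {u p : Fin N → ℝ} {G : ((Fin N → ℝ) × (Fin N → ℝ)) →L[ℝ] (Fin N → ℝ)}
    (hG : HasFDerivAt (fun q : (Fin N → ℝ) × (Fin N → ℝ) => f q.1 q.2) G (u, p))
    (v : (Fin N → ℝ) × (Fin N → ℝ)) : G v = Du f u p *ᵥ v.1 + Dp f u p *ᵥ v.2 := by
  have h1 : Du f u p = LinearMap.toMatrix' (G ∘L ContinuousLinearMap.inl ℝ _ _).toLinearMap := by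
    ext i j
    have h := hasFDerivAt_pi'.1 (hG.comp (f := fun u' => (u', p)) u (hasFDerivAt_prodMk_left u p)) i
    rw [LinearMap.toMatrix'_apply]
    exact congrArg (fun T => T (Pi.single j 1)) h.fderiv
  have h2 : Dp f u p = LinearMap.toMatrix' (G ∘L ContinuousLinearMap.inr ℝ _ _).toLinearMap := by
    ext i j
    have h := hasFDerivAt_pi'.1
      (hG.comp (f := fun p' => (u, p')) p (hasFDerivAt_prodMk_right u p)) i
    rw [LinearMap.toMatrix'_apply]
    exact congrArg (fun T => T (Pi.single j 1)) h.fderiv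
  rw [h1, h2, LinearMap.toMatrix'_mulVec, LinearMap.toMatrix'_mulVec]
  change G v = G (v.1, 0) + G (0, v.2)
  rw [← map_add]
  simp

theorem travelling_wave_decay_atTop {N : ℕ} {A : Matrix (Fin N) (Fin N) ℝ} (hA : IsUnit A.det)
    {f : (Fin N → ℝ) → (Fin N → ℝ) → Fin N → ℝ}
    (hf : ContDiff ℝ 1 (fun q : (Fin N → ℝ) × (Fin N → ℝ) => f q.1 q.2))
    {c : ℝ} {φ φ₁ φ₂ : ℝ → Fin N → ℝ} {E : Fin N → ℝ}
    (hφ : ∀ x, HasDerivAt φ (φ₁ x) x) (hφ₁ : ∀ x, HasDerivAt φ₁ (φ₂ x) x)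
    (hbdd : ∃ m, ∀ x, ‖φ x‖ ≤ m ∧ ‖φ₁ x‖ ≤ m)
    (heq : ∀ x, A *ᵥ φ₂ x + c • φ₁ x + f (φ x) (φ₁ x) = 0) (hlim : Tendsto φ atTop (𝓝 E))
    (hchar : ∀ μ : ℂ,
      (μ ^ 2 • A.map Complex.ofReal
        + μ • ((c : ℂ) • (1 : Matrix (Fin N) (Fin N) ℂ) + (Dp f E 0).map Complex.ofReal)
        + (Du f E 0).map Complex.ofReal).det = 0 → μ.re ≠ 0) :
    ∃ K > 0, ∃ γ > 0, ∀ x, 0 ≤ x → ‖φ x - E‖ + ‖φ₁ x‖ ≤ K * Real.exp (-γ * x) := by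
  let T : (Fin N → ℝ) →L[ℝ] (Fin N → ℝ) := LinearMap.toContinuousLinearMap A⁻¹.mulVecLin
  have hT (v : Fin N → ℝ) : T v = A⁻¹ *ᵥ v := rfl
  have hG := (hf.differentiable one_ne_zero (E, 0)).hasFDerivAt
  have hsnd := (ContinuousLinearMap.snd ℝ (Fin N → ℝ) (Fin N → ℝ)).hasFDerivAt (x := (E, 0))
  refine exponential_decay_of_hyperbolic (F := fun v => T (c • v.2 + f v.1 v.2))
    (S := A⁻¹ * Du f E 0) (R := A⁻¹ * (c • 1 + Dp f E 0))
    (T.continuous.comp ((continuous_snd.const_smul c).add hf.continuous))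
    (T.hasFDerivAt.comp (E, 0) ((hsnd.const_smul c).add hG)) (fun v => ?_) hφ hφ₁ hbdd
    (fun x => ?_) hlim (fun μ hμ => hchar μ ?_)
  · change T (c • v.2 + fderiv ℝ (fun q : (Fin N → ℝ) × (Fin N → ℝ) => f q.1 q.2) (E, 0) v) = _
    rw [fderiv_eq_Du_add_Dp hG, hT, ← Matrix.mulVec_mulVec, ← Matrix.mulVec_mulVec,
      ← Matrix.mulVec_add, Matrix.add_mulVec, Matrix.smul_mulVec, Matrix.one_mulVec]
    congr 1
    abel
  · have h : c • φ₁ x + f (φ x) (φ₁ x) = -(A *ᵥ φ₂ x) := by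
      rw [eq_neg_iff_add_eq_zero, ← heq x]
      abel
    change φ₂ x = -T (c • φ₁ x + f (φ x) (φ₁ x))
    rw [h, hT, Matrix.mulVec_neg, neg_neg, Matrix.mulVec_mulVec, Matrix.nonsing_inv_mul _ hA,
      Matrix.one_mulVec]
  · have hmul (X : Matrix (Fin N) (Fin N) ℝ) :
        A.map Complex.ofReal * (A⁻¹ * X).map Complex.ofReal = X.map Complex.ofReal := by
      have h : (A * (A⁻¹ * X)).map Complex.ofRealHom =
          A.map Complex.ofRealHom * (A⁻¹ * X).map Complex.ofRealHom := Matrix.map_mul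
      rw [Matrix.mul_nonsing_inv_cancel_left _ _ hA] at h
      exact h.symm
    have hadd : (c • 1 + Dp f E 0).map Complex.ofReal =
        (c : ℂ) • (1 : Matrix (Fin N) (Fin N) ℂ) + (Dp f E 0).map Complex.ofReal := by
      ext i j
      by_cases hij : i = j <;> simp [hij]
    have h := congrArg ((A.map Complex.ofReal).det * ·) hμ
    simp only [mul_zero] at h
    rwa [← Matrix.det_mul, mul_add, mul_add, Matrix.mul_smul, Matrix.mul_smul, mul_one, hmul,
      hmul, hadd] at h

/-- if the characteristic equations at ±∞ have no roots with zero
real part, then the travelling-wave profile converges exponentially to its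
limits E^±, together with its derivative. -/
theorem travelling_wave_exponential_convergence
    (N : ℕ) (hN : 1 ≤ N)
    (A : Matrix (Fin N) (Fin N) ℝ)
    (hAdiag : ∀ i j, i ≠ j → A i j = 0) (hApos : ∀ i, 0 < A i i)
    (f : (Fin N → ℝ) → (Fin N → ℝ) → Fin N → ℝ)
    (hf : ContDiff ℝ 1 (fun q : (Fin N → ℝ) × (Fin N → ℝ) => f q.1 q.2))
    (c : ℝ) (φ : ℝ → Fin N → ℝ)
    (hφC2 : ContDiff ℝ 2 φ)
    (hφbdd : ∃ M, ∀ x, ‖φ x‖ ≤ M ∧ ‖deriv φ x‖ ≤ M)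
    (heq : ∀ x, A.mulVec (deriv (deriv φ) x) + c • deriv φ x
      + f (φ x) (deriv φ x) = 0)
    (Em Ep : Fin N → ℝ) (hne : Em ≠ Ep)
    (hlimp : Tendsto φ atTop (𝓝 Ep)) (hlimm : Tendsto φ atBot (𝓝 Em))
    (hcharp : ∀ μ : ℂ,
      (μ ^ 2 • A.map Complex.ofReal
        + μ • ((c : ℂ) • (1 : Matrix (Fin N) (Fin N) ℂ)
            + (Dp f Ep 0).map Complex.ofReal)
        + (Du f Ep 0).map Complex.ofReal).det = 0 → μ.re ≠ 0)
    (hcharm : ∀ μ : ℂ,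
      (μ ^ 2 • A.map Complex.ofReal
        + μ • ((c : ℂ) • (1 : Matrix (Fin N) (Fin N) ℂ)
            + (Dp f Em 0).map Complex.ofReal)
        + (Du f Em 0).map Complex.ofReal).det = 0 → μ.re ≠ 0) :
    ∃ K > (0 : ℝ), ∃ γ > (0 : ℝ),
      (∀ x : ℝ, 0 ≤ x →
        ‖φ x - Ep‖ + ‖deriv φ x‖ ≤ K * Real.exp (-γ * x)) ∧
      (∀ x : ℝ, x ≤ 0 →
        ‖φ x - Em‖ + ‖deriv φ x‖ ≤ K * Real.exp (γ * x)) := by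
  have hA : IsUnit A.det := by
    rw [show A = Matrix.diagonal fun i => A i i from
      ((Matrix.isDiag_iff_diagonal_diag A).1 fun i j hij => hAdiag i j hij).symm,
      Matrix.det_diagonal]
    exact (Finset.prod_pos fun i _ => hApos i).ne'.isUnit
  have hd₁ (x : ℝ) : HasDerivAt φ (deriv φ x) x :=
    (hφC2.differentiable two_ne_zero x).hasDerivAt
  have hd₂ (x : ℝ) : HasDerivAt (deriv φ) (deriv (deriv φ) x) x :=
    ((ContDiff.deriv' (n := 1) hφC2).differentiable one_ne_zero x).hasDerivAt
  obtain ⟨K₁, hK₁, γ₁, hγ₁, h₁⟩ :=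
    travelling_wave_decay_atTop hA hf hd₁ hd₂ hφbdd heq hlimp hcharp
  obtain ⟨K₂, hK₂, γ₂, hγ₂, h₂⟩ := travelling_wave_decay_atTop hA
    (f := fun u p => f u (-p)) (c := -c) (φ := fun x => φ (-x)) (φ₁ := fun x => -deriv φ (-x))
    (φ₂ := fun x => deriv (deriv φ) (-x)) (E := Em)
    (hf.comp (contDiff_fst.prodMk contDiff_snd.neg))
    (fun x => by simpa using! (hd₁ (-x)).scomp x (hasDerivAt_neg x))
    (fun x => by simpa using! ((hd₂ (-x)).scomp x (hasDerivAt_neg x)).neg)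
    (by simpa using hφbdd.imp fun m hm x => hm (-x))
    (fun x => by simpa using heq (-x))
    (hlimm.comp tendsto_neg_atTop_atBot)
    (fun μ hμ => by
      have hDp : Dp (fun u p => f u (-p)) Em 0 = -Dp f Em 0 := by
        ext i j
        have h := fderiv_comp_smul (𝕜 := ℝ) (f := fun p => f Em p i) (x := 0) (-1)
        simp only [neg_smul, one_smul, neg_zero] at h
        exact congrArg (fun L => L (Pi.single j 1)) h
      have hDu : Du (fun u p => f u (-p)) Em 0 = Du f Em 0 := by
        ext i j
        simp [Du]
      have h := hcharm (-μ)
      rw [hDp, hDu] at hμ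
      have hre : (-μ).re ≠ 0 := h (by
        rw [← hμ]
        congr 1
        ext i j
        simp)
      simpa using hre)
  refine ⟨max K₁ K₂, lt_max_of_lt_left hK₁, min γ₁ γ₂, lt_min hγ₁ hγ₂, fun x hx => ?_,
    fun x hx => ?_⟩
  · refine (h₁ x hx).trans ?_
    gcongr
    · exact le_max_left _ _
    · exact min_le_left _ _
  · have h := h₂ (-x) (by linarith)
    rw [neg_neg, norm_neg] at h
    refine h.trans ?_
    gcongr ?_ * Real.exp ?_
    · exact le_max_right _ _
    · nlinarith [min_le_right γ₁ γ₂]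
end

section
/- Let B and C be real N×N matrices and let λ ∈ ℂ be such that for every k ∈ ℝ the complex N×N matrix −k² A + i k (c·I + C) + B − λ·I is invertible. Then for every bounded continuous function h : ℝ → ℂ^N there exists a unique bounded C² function w : ℝ → ℂ^N satisfying A w''(x) + (c·I + C) w'(x) + B w(x) − λ w(x) = −h(x) for all x ∈ ℝ; moreover there is a constant K > 0, independent of h, such that sup_x |w(x)| ≤ K · sup_x |h(x)|. -/
open Matrix Filter Topology

section Hyperbolic

variable {V : Type*} [NormedAddCommGroup V] [NormedSpace ℂ V] [NormedSpace ℝ V]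
  [IsScalarTower ℝ ℂ V]

theorem ContinuousLinearMap.comp_hasDerivAt_real {W : Type*} [NormedAddCommGroup W]
    [NormedSpace ℂ W] [NormedSpace ℝ W] [IsScalarTower ℝ ℂ W] (L : V →L[ℂ] W) {u : ℝ → V} {u' : V}
    {x : ℝ} (hu : HasDerivAt u u' x) : HasDerivAt (fun y => L (u y)) (L u') x :=
  (L.restrictScalars ℝ).hasFDerivAt.comp_hasDerivAt x hu

theorem hasDerivAt_cexp_mul_ofReal (μ : ℂ) (x : ℝ) :
    HasDerivAt (fun y : ℝ => Complex.exp (μ * y)) (Complex.exp (μ * x) * μ) x := by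
  have h : HasDerivAt (fun y : ℝ => μ * (y : ℂ)) μ x := by
    simpa using (Complex.ofRealCLM.hasDerivAt (x := x)).const_mul μ
  exact h.cexp

/-- The scalar operator `u ↦ u' - μ u` is injective on bounded functions when `re μ ≠ 0`. -/
theorem eq_zero_of_hasDerivAt_smul_of_bounded {μ : ℂ} (hμ : μ.re ≠ 0) {u : ℝ → V}
    (hu : ∀ x, HasDerivAt u (μ • u x) x) {M : ℝ} (hM : ∀ x, ‖u x‖ ≤ M) : u = 0 := by
  have key : ∀ x, u x = Complex.exp (μ * x) • u 0 := by
    have hd : ∀ x : ℝ, HasDerivAt (fun y : ℝ => Complex.exp (-μ * y) • u y) 0 x := by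
      intro x
      refine ((hasDerivAt_cexp_mul_ofReal (-μ) x).smul (hu x)).congr_deriv ?_
      rw [smul_smul, ← add_smul]
      simp
    intro x
    have := is_const_of_deriv_eq_zero (fun x => (hd x).differentiableAt) (fun x => (hd x).deriv) x 0
    simp only [Complex.ofReal_zero, mul_zero, Complex.exp_zero, one_smul] at this
    rw [← this, smul_smul, ← Complex.exp_add]
    simp
  have h0 : u 0 = 0 := by
    by_contra hne
    have hpos : 0 < ‖u 0‖ := norm_pos_iff.mpr hne
    have h1 := hM (M / ‖u 0‖ / μ.re)
    rw [key, norm_smul, Complex.norm_exp] at h1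
    have h2 : (μ * ((M / ‖u 0‖ / μ.re : ℝ) : ℂ)).re = M / ‖u 0‖ := by
      rw [Complex.re_mul_ofReal]
      field_simp
    rw [h2] at h1
    have h3 := mul_le_mul_of_nonneg_right (Real.add_one_le_exp (M / ‖u 0‖)) hpos.le
    rw [add_mul, div_mul_cancel₀ _ hpos.ne'] at h3
    linarith
  funext x
  rw [key, h0, smul_zero, Pi.zero_apply]

theorem exists_bounded_hasDerivAt_smul_add_of_re_neg [CompleteSpace V] {μ : ℂ} (hμ : μ.re < 0)
    {g : ℝ → V} (hg : Continuous g) {G : ℝ} (hG : ∀ x, ‖g x‖ ≤ G) :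
    ∃ u : ℝ → V, (∀ x, HasDerivAt u (μ • u x + g x) x) ∧ ∀ x, ‖u x‖ ≤ |μ.re|⁻¹ * G := by
  have ha : 0 < -μ.re := by linarith
  set f : ℝ → V := fun s => Complex.exp (-μ * s) • g s with hf
  have hfc : Continuous f := by fun_prop
  have hfb : ∀ s, ‖f s‖ ≤ Real.exp (-μ.re * s) * G := by
    intro s
    rw [hf, norm_smul, Complex.norm_exp, Complex.re_mul_ofReal, Complex.neg_re]
    gcongr
    exact hG s
  have hgi : ∀ x, MeasureTheory.IntegrableOn (fun s => Real.exp (-μ.re * s) * G) (Set.Iic x) :=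
    fun x => (integrableOn_exp_mul_Iic ha x).mul_const G
  have hfi : ∀ x, MeasureTheory.IntegrableOn f (Set.Iic x) := fun x =>
    (hgi x).mono' hfc.aestronglyMeasurable (Filter.Eventually.of_forall hfb)
  have hF : ∀ x, HasDerivAt (fun y => ∫ s in Set.Iic y, f s) (f x) x := by
    intro x
    have h1 := ((hfc.integral_hasStrictDerivAt 0 x).hasDerivAt).add_const (∫ s in Set.Iic 0, f s)
    refine h1.congr_of_eventuallyEq (Filter.Eventually.of_forall fun y => ?_)
    simp only [← intervalIntegral.integral_Iic_sub_Iic (hfi 0) (hfi y), sub_add_cancel]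
  refine ⟨fun x => Complex.exp (μ * x) • ∫ s in Set.Iic x, f s, fun x => ?_, fun x => ?_⟩
  · refine ((hasDerivAt_cexp_mul_ofReal μ x).smul (hF x)).congr_deriv ?_
    rw [hf, add_comm, smul_smul, smul_smul, ← Complex.exp_add, mul_comm (Complex.exp _)]
    simp
  · rw [norm_smul, Complex.norm_exp, Complex.re_mul_ofReal]
    have h1 := MeasureTheory.norm_integral_le_of_norm_le (hgi x)
      (Filter.Eventually.of_forall hfb)
    rw [MeasureTheory.integral_mul_const, integral_exp_mul_Iic ha] at h1
    refine (mul_le_mul_of_nonneg_left h1 (Real.exp_pos _).le).trans_eq ?_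
    rw [abs_of_neg hμ, ← mul_assoc, ← mul_div_assoc, ← Real.exp_add]
    simp

/-- The scalar equation `u' = μ u + g` has a bounded solution when `re μ ≠ 0` and `g` is
bounded. -/
theorem exists_bounded_hasDerivAt_smul_add [CompleteSpace V] {μ : ℂ} (hμ : μ.re ≠ 0)
    {g : ℝ → V} (hg : Continuous g) {G : ℝ} (hG : ∀ x, ‖g x‖ ≤ G) :
    ∃ u : ℝ → V, (∀ x, HasDerivAt u (μ • u x + g x) x) ∧ ∀ x, ‖u x‖ ≤ |μ.re|⁻¹ * G := by
  rcases hμ.lt_or_gt with h | h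
  · exact exists_bounded_hasDerivAt_smul_add_of_re_neg h hg hG
  · obtain ⟨u, hu, hub⟩ := exists_bounded_hasDerivAt_smul_add_of_re_neg (μ := -μ) (by simpa using h)
      (g := fun x => -g (-x)) (by fun_prop) (G := G) (fun x => by simpa using hG (-x))
    refine ⟨fun x => u (-x), fun x => ?_, fun x => by simpa using hub (-x)⟩
    refine ((hu (-x)).scomp x (hasDerivAt_neg x)).congr_deriv ?_
    simp

open Polynomial in
/-- If a polynomial in `M` without imaginary roots kills a bounded solution of `u' = M u`, the
solution vanishes. -/
theorem eq_zero_of_hasDerivAt_of_bounded_of_aeval_eq_zero (M : V →L[ℂ] V) (l : Multiset ℂ)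
    (hl : ∀ μ ∈ l, μ.re ≠ 0) {u : ℝ → V} (hu : ∀ x, HasDerivAt u (M (u x)) x)
    (hb : ∃ b, ∀ x, ‖u x‖ ≤ b)
    (hp : ∀ x, aeval M (l.map fun μ => X - C μ).prod (u x) = 0) : u = 0 := by
  induction l using Multiset.induction_on generalizing u with
  | empty => funext x; simpa using hp x
  | cons μ l ih =>
    obtain ⟨b, hb⟩ := hb
    have hw : (fun x => (M - algebraMap ℂ _ μ) (u x)) = 0 := by
      refine ih (fun ν hν => hl ν (Multiset.mem_cons_of_mem hν)) (fun x => ?_)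
        ⟨‖M - algebraMap ℂ _ μ‖ * b, fun x => ?_⟩ fun x => ?_
      · convert (M - algebraMap ℂ (V →L[ℂ] V) μ).comp_hasDerivAt_real (hu x) using 1
        simp [Algebra.algebraMap_eq_smul_one]
      · exact ((M - algebraMap ℂ (V →L[ℂ] V) μ).le_opNorm _).trans (by gcongr; exact hb x)
      · have := hp x
        rw [Multiset.map_cons, Multiset.prod_cons, mul_comm, map_mul] at this
        simpa using this
    refine eq_zero_of_hasDerivAt_smul_of_bounded (hl μ (Multiset.mem_cons_self _ _))
      (fun x => ?_) hb
    have h1 := congrFun hw x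
    simp only [Algebra.algebraMap_eq_smul_one, _root_.sub_apply,
      _root_.smul_apply, one_apply_eq_self, Pi.zero_apply,
      sub_eq_zero] at h1
    rw [← h1]
    exact hu x

open Polynomial in
/-- The equation `u' = M u + g` is solvable by bounded functions modulo the range of a polynomial
in `M` without imaginary roots. -/
theorem exists_bounded_hasDerivAt_modulo_aeval [CompleteSpace V] (M : V →L[ℂ] V) (l : Multiset ℂ)
    (hl : ∀ μ ∈ l, μ.re ≠ 0) :
    ∃ K > (0 : ℝ), ∀ (g : ℝ → V) (G : ℝ), Continuous g → (∀ x, ‖g x‖ ≤ G) →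
      ∃ u s : ℝ → V, Continuous s ∧ (∀ x, ‖u x‖ ≤ K * G) ∧ (∀ x, ‖s x‖ ≤ K * G) ∧
        ∀ x, HasDerivAt u (M (u x) + g x - aeval M (l.map fun μ => X - C μ).prod (s x)) x := by
  induction l using Multiset.induction_on with
  | empty =>
    refine ⟨1, one_pos, fun g G hg hG => ⟨0, g, hg, fun x => ?_, by simpa using hG, fun x => ?_⟩⟩
    · simpa using (norm_nonneg _).trans (hG x)
    · simp
  | cons μ l ih =>
    obtain ⟨K, hK, H⟩ := ih fun ν hν => hl ν (Multiset.mem_cons_of_mem hν)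
    set P : V →L[ℂ] V := aeval M (l.map fun μ => X - C μ).prod with hP
    have hμ := hl μ (Multiset.mem_cons_self _ _)
    have hμ' : 0 < |μ.re|⁻¹ := inv_pos.mpr (abs_pos.mpr hμ)
    refine ⟨K + (‖P‖ + 1) * (|μ.re|⁻¹ * K), by positivity, fun g G hg hG => ?_⟩
    have hG0 : 0 ≤ G := (norm_nonneg _).trans (hG 0)
    obtain ⟨u, s, hs, hub, hsb, hu⟩ := H g G hg hG
    obtain ⟨v, hv, hvb⟩ := exists_bounded_hasDerivAt_smul_add hμ hs hsb
    refine ⟨fun x => u x + P (v x), v,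
      continuous_iff_continuousAt.mpr fun x => (hv x).continuousAt, fun x => ?_, fun x => ?_,
      fun x => ?_⟩
    · calc ‖u x + P (v x)‖ ≤ K * G + ‖P‖ * (|μ.re|⁻¹ * (K * G)) :=
            (norm_add_le _ _).trans (add_le_add (hub x)
              ((P.le_opNorm _).trans (by gcongr; exact hvb x)))
        _ ≤ K * G + (‖P‖ + 1) * (|μ.re|⁻¹ * (K * G)) := by gcongr; linarith
        _ = _ := by ring
    · calc ‖v x‖ ≤ 0 + 1 * (|μ.re|⁻¹ * (K * G)) := by simpa using hvb x
        _ ≤ K * G + (‖P‖ + 1) * (|μ.re|⁻¹ * (K * G)) := by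
          gcongr
          · positivity
          · linarith [norm_nonneg P]
        _ = _ := by ring
    · have hcomm : M (P (v x)) = P (M (v x)) := by
        have h1 : M * P = P * M := by
          have := Polynomial.aeval_X (R := ℂ) M
          rw [hP]
          nth_rewrite 1 [← this]
          nth_rewrite 4 [← this]
          rw [← map_mul, ← map_mul, mul_comm]
        exact congrArg (fun L : V →L[ℂ] V => L (v x)) h1
      refine ((hu x).add (P.comp_hasDerivAt_real (hv x))).congr_deriv ?_
      rw [Multiset.map_cons, Multiset.prod_cons, mul_comm, map_mul, ← hP]
      simp only [ContinuousLinearMap.mul_def, ContinuousLinearMap.comp_apply, map_sub, aeval_X, aeval_C,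
        Algebra.algebraMap_eq_smul_one, _root_.sub_apply, map_add, map_smul,
        _root_.smul_apply, one_apply_eq_self, hcomm]
      abel

/-- Hyperbolic linear systems with constant coefficients: `u' = M u` has no nonzero bounded
solution and `u' = M u + g` has a bounded one, with a uniform estimate. -/
theorem bounded_solutions_of_eigenvalues_re_ne_zero [FiniteDimensional ℂ V] (M : V →L[ℂ] V)
    (hM : ∀ (μ : ℂ) (v : V), v ≠ 0 → M v = μ • v → μ.re ≠ 0) :
    (∀ u : ℝ → V, (∀ x, HasDerivAt u (M (u x)) x) → (∃ b, ∀ x, ‖u x‖ ≤ b) → u = 0) ∧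
    ∃ K > (0 : ℝ), ∀ (g : ℝ → V) (G : ℝ), Continuous g → (∀ x, ‖g x‖ ≤ G) →
      ∃ u : ℝ → V, (∀ x, ‖u x‖ ≤ K * G) ∧ ∀ x, HasDerivAt u (M (u x) + g x) x := by
  have : CompleteSpace V := FiniteDimensional.complete ℂ V
  let f : Module.End ℂ V := M
  have hl : ∀ μ ∈ (minpoly ℂ f).roots, μ.re ≠ 0 := by
    intro μ hμ
    obtain ⟨v, hv⟩ :=
      (Module.End.hasEigenvalue_of_isRoot (Polynomial.isRoot_of_mem_roots hμ)).exists_hasEigenvector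
    exact hM μ v hv.2 hv.apply_eq_smul
  have hp : Polynomial.aeval M
      ((minpoly ℂ f).roots.map fun μ => Polynomial.X - Polynomial.C μ).prod = 0 := by
    have h1 := (IsAlgClosed.splits (minpoly ℂ f)).eq_prod_roots
    rw [(minpoly.monic (Algebra.IsIntegral.isIntegral f)).leadingCoeff, Polynomial.C_1,
      one_mul] at h1
    rw [← h1, show M = Module.End.toContinuousLinearMap V f from rfl,
      Polynomial.aeval_algHom_apply, minpoly.aeval, map_zero]
  refine ⟨fun u hu hb => eq_zero_of_hasDerivAt_of_bounded_of_aeval_eq_zero M _ hl hu hb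
    fun x => by rw [hp, _root_.zero_apply], ?_⟩
  obtain ⟨K, hK, H⟩ := exists_bounded_hasDerivAt_modulo_aeval M _ hl
  refine ⟨K, hK, fun g G hg hG => ?_⟩
  obtain ⟨u, s, -, hub, -, hu⟩ := H g G hg hG
  exact ⟨u, hub, fun x => by simpa [hp] using hu x⟩

end Hyperbolic

section SecondOrder

variable {n : Type*} [Fintype n]

theorem HasDerivAt.mulVec_const {w : ℝ → n → ℂ} {w' : n → ℂ} {x : ℝ} (M : Matrix n n ℂ)
    (hw : HasDerivAt w w' x) : HasDerivAt (fun t => M *ᵥ w t) (M *ᵥ w') x :=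
  (LinearMap.toContinuousLinearMap M.mulVecLin).comp_hasDerivAt_real hw

variable [DecidableEq n]

/-- The first-order system `(w, z)' = (z, -A⁻¹ (D z + B w))` equivalent to
`A w'' + D w' + B w = 0`. -/
noncomputable def Matrix.secondOrderCompanion (A D B : Matrix n n ℂ) :
    (n → ℂ) × (n → ℂ) →L[ℂ] (n → ℂ) × (n → ℂ) :=
  LinearMap.toContinuousLinearMap ((LinearMap.snd ℂ (n → ℂ) (n → ℂ)).prod
    (-(A⁻¹.mulVecLin ∘ₗ (D.mulVecLin ∘ₗ LinearMap.snd ℂ _ _ + B.mulVecLin ∘ₗ LinearMap.fst ℂ _ _))))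

theorem Matrix.secondOrderCompanion_apply (A D B : Matrix n n ℂ) (p : (n → ℂ) × (n → ℂ)) :
    secondOrderCompanion A D B p = (p.2, -(A⁻¹ *ᵥ (D *ᵥ p.2 + B *ᵥ p.1))) :=
  rfl

variable {A D B : Matrix n n ℂ}

theorem Matrix.secondOrderCompanion_eigenvalue_re_ne_zero (hA : IsUnit A.det)
    (hsymb : ∀ k : ℝ, IsUnit ((-(k : ℂ) ^ 2) • A + (Complex.I * (k : ℂ)) • D + B).det)
    (μ : ℂ) (p : (n → ℂ) × (n → ℂ)) (hp : p ≠ 0) (hμ : secondOrderCompanion A D B p = μ • p) :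
    μ.re ≠ 0 := by
  intro hre
  obtain ⟨u, v⟩ := p
  rw [secondOrderCompanion_apply, Prod.smul_mk, Prod.mk.injEq] at hμ
  obtain ⟨rfl, h2⟩ := hμ
  have hμI : μ = Complex.I * (μ.im : ℂ) := by
    apply Complex.ext <;> simp [hre]
  have hu : u ≠ 0 := by
    rintro rfl
    simp at hp
  refine (hsymb μ.im).ne_zero (Matrix.exists_mulVec_eq_zero_iff.mp ⟨u, hu, ?_⟩)
  have h3 := congrArg (A *ᵥ ·) h2
  simp only [mulVec_neg, mulVec_mulVec, Matrix.mul_nonsing_inv A hA, one_mulVec, mulVec_smul,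
    smul_smul] at h3
  have hsq : -(μ.im : ℂ) ^ 2 = μ * μ := by
    rw [hμI, mul_mul_mul_comm, Complex.I_mul_I]
    simp [sq]
  rw [← hμI, hsq]
  simp only [add_mulVec, smul_mulVec]
  rw [← h3]
  abel

theorem hasDerivAt_secondOrderCompanion (hA : IsUnit A.det) {w z : ℝ → n → ℂ} {y h : n → ℂ} {x : ℝ}
    (hw : HasDerivAt w (z x) x) (hz : HasDerivAt z y x)
    (heq : A *ᵥ y + D *ᵥ z x + B *ᵥ w x = h) :
    HasDerivAt (fun t => (w t, z t))
      (A.secondOrderCompanion D B (w x, z x) + (0, A⁻¹ *ᵥ h)) x := by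
  refine (hw.prodMk hz).congr_deriv ?_
  rw [secondOrderCompanion_apply, Prod.mk_add_mk, add_zero, ← heq, ← mulVec_neg, ← mulVec_add,
    show -(D *ᵥ z x + B *ᵥ w x) + (A *ᵥ y + D *ᵥ z x + B *ᵥ w x) = A *ᵥ y by abel,
    mulVec_mulVec, Matrix.nonsing_inv_mul A hA, one_mulVec]

/-- A bounded solution of `A w'' + D w' + B w = 0` vanishes; no bound on `w'` is assumed. -/
theorem eq_zero_of_secondOrder_of_bounded (hA : IsUnit A.det)
    (hsymb : ∀ k : ℝ, IsUnit ((-(k : ℂ) ^ 2) • A + (Complex.I * (k : ℂ)) • D + B).det)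
    {w z y : ℝ → n → ℂ} (hw : ∀ x, HasDerivAt w (z x) x) (hz : ∀ x, HasDerivAt z (y x) x)
    (heq : ∀ x, A *ᵥ y x + D *ᵥ z x + B *ᵥ w x = 0) {b : ℝ} (hb : ∀ x, ‖w x‖ ≤ b) : w = 0 := by
  have hB : IsUnit B.det := by simpa using hsymb 0
  have huniq := (bounded_solutions_of_eigenvalues_re_ne_zero _
    (secondOrderCompanion_eigenvalue_re_ne_zero hA hsymb)).1
  -- `v` is a primitive of `w` solving the same equation, so its increments are bounded solutions.
  set v : ℝ → n → ℂ := fun x => -(B⁻¹ *ᵥ (A *ᵥ z x + D *ᵥ w x)) with hv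
  have hBv : ∀ x, A *ᵥ z x + D *ᵥ w x + B *ᵥ v x = 0 := by
    intro x
    rw [hv, mulVec_neg, mulVec_mulVec, Matrix.mul_nonsing_inv B hB, one_mulVec, add_neg_cancel]
  have hvd : ∀ x, HasDerivAt v (w x) x := by
    intro x
    refine ((((hz x).mulVec_const A).add ((hw x).mulVec_const D)).mulVec_const B⁻¹).neg.congr_deriv ?_
    rw [eq_neg_of_add_eq_zero_left (heq x), mulVec_neg, neg_neg, mulVec_mulVec,
      Matrix.nonsing_inv_mul B hB, one_mulVec]
  have hconst : ∀ t x, v (x + t) = v x := by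
    intro t x
    have h0 := huniq (fun x => (v (x + t) - v x, w (x + t) - w x)) (fun x => ?_)
      ⟨max (b * |t|) (b + b), fun x => ?_⟩
    · exact sub_eq_zero.mp (congrArg Prod.fst (congrFun h0 x))
    · have h1 := hasDerivAt_secondOrderCompanion (A := A) (D := D) (B := B) hA (h := 0)
        (w := fun x => v (x + t) - v x) (z := fun x => w (x + t) - w x)
        (((hvd (x + t)).comp_add_const x t).sub (hvd x))
        (((hw (x + t)).comp_add_const x t).sub (hw x)) (by
          have := congrArg₂ (· - ·) (hBv (x + t)) (hBv x)
          simp only [sub_zero] at this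
          rw [← this]
          simp only [mulVec_sub]
          abel)
      simpa [Prod.mk_zero_zero] using h1
    · refine max_le_max ?_ ((norm_sub_le _ _).trans (add_le_add (hb _) (hb _)))
      have := Convex.norm_image_sub_le_of_norm_hasDerivWithin_le
        (fun x _ => (hvd x).hasDerivWithinAt) (fun x _ => hb x) convex_univ
        (Set.mem_univ x) (Set.mem_univ (x + t))
      simpa using this
  funext x
  have hv0 : v = fun _ => v 0 := funext fun t => by simpa using hconst t 0
  have h1 := hvd x
  rw [hv0] at h1
  exact h1.unique (hasDerivAt_const x _)

/-- Bounded solvability of `A w'' + D w' + B w = h` with a uniform estimate. -/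
theorem exists_bounded_secondOrder_solution (hA : IsUnit A.det)
    (hsymb : ∀ k : ℝ, IsUnit ((-(k : ℂ) ^ 2) • A + (Complex.I * (k : ℂ)) • D + B).det) :
    ∃ K > (0 : ℝ), ∀ (h : ℝ → n → ℂ) (G : ℝ), Continuous h → (∀ x, ‖h x‖ ≤ G) →
      ∃ w z y : ℝ → n → ℂ, (∀ x, HasDerivAt w (z x) x) ∧ (∀ x, HasDerivAt z (y x) x) ∧
        Continuous y ∧ (∀ x, A *ᵥ y x + D *ᵥ z x + B *ᵥ w x = h x) ∧ ∀ x, ‖w x‖ ≤ K * G := by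
  obtain ⟨K, hK, H⟩ := (bounded_solutions_of_eigenvalues_re_ne_zero _
    (secondOrderCompanion_eigenvalue_re_ne_zero hA hsymb)).2
  set L : (n → ℂ) →L[ℂ] (n → ℂ) := LinearMap.toContinuousLinearMap A⁻¹.mulVecLin
  have hL : ∀ p, L p = A⁻¹ *ᵥ p := fun _ => rfl
  refine ⟨K * (‖L‖ + 1), by positivity, fun h G hh hG => ?_⟩
  obtain ⟨u, hub, hu⟩ := H (fun x => (0, A⁻¹ *ᵥ h x)) ((‖L‖ + 1) * G)
    (by fun_prop) (fun x => by
      have hG0 : 0 ≤ G := (norm_nonneg _).trans (hG x)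
      rw [Prod.norm_mk, norm_zero, max_eq_right (norm_nonneg _), ← hL]
      calc ‖L (h x)‖ ≤ ‖L‖ * G := (L.le_opNorm _).trans (by gcongr; exact hG x)
        _ ≤ (‖L‖ + 1) * G := by gcongr; linarith)
  have huc : Continuous u := continuous_iff_continuousAt.mpr fun x => (hu x).continuousAt
  refine ⟨fun x => (u x).1, fun x => (u x).2,
    fun x => -(A⁻¹ *ᵥ (D *ᵥ (u x).2 + B *ᵥ (u x).1)) + A⁻¹ *ᵥ h x, fun x => ?_, fun x => ?_,
    by fun_prop, fun x => ?_, fun x => ?_⟩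
  · refine ((ContinuousLinearMap.fst ℂ _ _).comp_hasDerivAt_real (hu x)).congr_deriv ?_
    simp [secondOrderCompanion_apply]
  · refine ((ContinuousLinearMap.snd ℂ _ _).comp_hasDerivAt_real (hu x)).congr_deriv ?_
    simp [secondOrderCompanion_apply]
  · simp only [mulVec_add, mulVec_neg, mulVec_mulVec, ← mul_assoc, Matrix.mul_nonsing_inv A hA,
      one_mul, one_mulVec]
    abel
  · rw [mul_assoc]
    exact (norm_fst_le _).trans (hub x)

end SecondOrder

/-- resolvent equation for the constant-coefficient operator
w ↦ A w'' + (cI + C) w' + B w. If the Fourier symbol −k²A + ik(cI+C) + B − λI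
is invertible for all k ∈ ℝ, then for each bounded continuous h there is a
unique bounded C² solution w of A w'' + (cI+C) w' + B w − λ w = −h, with a
uniform bound sup |w| ≤ K sup |h| where K is independent of h. -/
theorem constant_coefficient_resolvent
    (N : ℕ) (hN : 1 ≤ N)
    (A : Matrix (Fin N) (Fin N) ℝ)
    (hAdiag : ∀ i j, i ≠ j → A i j = 0) (hApos : ∀ i, 0 < A i i)
    (c : ℝ) (B C : Matrix (Fin N) (Fin N) ℝ) (lam : ℂ)
    (hsymb : ∀ k : ℝ,
      IsUnit ((-(k : ℂ) ^ 2) • A.map Complex.ofReal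
        + (Complex.I * (k : ℂ)) • ((c : ℂ) • (1 : Matrix (Fin N) (Fin N) ℂ)
            + C.map Complex.ofReal)
        + B.map Complex.ofReal - lam • (1 : Matrix (Fin N) (Fin N) ℂ)).det) :
    ∃ K > (0 : ℝ), ∀ h : ℝ → Fin N → ℂ, Continuous h →
      (∃ M, ∀ x, ‖h x‖ ≤ M) →
      (∃! w : ℝ → Fin N → ℂ,
        ContDiff ℝ 2 w ∧ (∃ M, ∀ x, ‖w x‖ ≤ M) ∧
        ∀ x : ℝ,
          (A.map Complex.ofReal).mulVec (deriv (deriv w) x)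
            + ((c : ℂ) • (1 : Matrix (Fin N) (Fin N) ℂ)
                + C.map Complex.ofReal).mulVec (deriv w x)
            + (B.map Complex.ofReal).mulVec (w x) - lam • w x = -h x) ∧
      (∀ w : ℝ → Fin N → ℂ,
        (ContDiff ℝ 2 w ∧ (∃ M, ∀ x, ‖w x‖ ≤ M) ∧
        ∀ x : ℝ,
          (A.map Complex.ofReal).mulVec (deriv (deriv w) x)
            + ((c : ℂ) • (1 : Matrix (Fin N) (Fin N) ℂ)
                + C.map Complex.ofReal).mulVec (deriv w x)
            + (B.map Complex.ofReal).mulVec (w x) - lam • w x = -h x) →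
        ∀ x : ℝ, ‖w x‖ ≤ K * ⨆ y : ℝ, ‖h y‖) := by
  have hA : IsUnit (A.map Complex.ofReal).det := by
    have h1 : A = diagonal fun i => A i i := by
      ext i j
      rcases eq_or_ne i j with rfl | hij
      · simp
      · rw [hAdiag i j hij, diagonal_apply_ne _ hij]
    rw [h1, diagonal_map Complex.ofReal_zero, det_diagonal, isUnit_iff_ne_zero]
    exact Finset.prod_ne_zero_iff.mpr fun i _ => Complex.ofReal_ne_zero.mpr (hApos i).ne'
  set A' : Matrix (Fin N) (Fin N) ℂ := A.map Complex.ofReal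
  set D : Matrix (Fin N) (Fin N) ℂ := (c : ℂ) • 1 + C.map Complex.ofReal
  set B' : Matrix (Fin N) (Fin N) ℂ := B.map Complex.ofReal
  have hs : ∀ k : ℝ, IsUnit ((-(k : ℂ) ^ 2) • A' + (Complex.I * (k : ℂ)) • D +
      (B' - lam • 1)).det := fun k => by
    rw [← add_sub_assoc]
    exact hsymb k
  have hBmul : ∀ v : Fin N → ℂ, (B' - lam • (1 : Matrix (Fin N) (Fin N) ℂ)) *ᵥ v =
      B' *ᵥ v - lam • v := fun v => by rw [sub_mulVec, smul_mulVec, one_mulVec]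
  have hd : ∀ {w : ℝ → Fin N → ℂ}, ContDiff ℝ 2 w →
      (∀ x, HasDerivAt w (deriv w x) x) ∧ ∀ x, HasDerivAt (deriv w) (deriv (deriv w) x) x := by
    intro w hw
    have hw' : ContDiff ℝ (1 + 1) w := by rwa [one_add_one_eq_two]
    obtain ⟨h1, -, h2⟩ := contDiff_succ_iff_deriv.mp hw'
    exact ⟨fun x => (h1 x).hasDerivAt, fun x => (h2.differentiable one_ne_zero x).hasDerivAt⟩
  obtain ⟨K, hK, H⟩ := exists_bounded_secondOrder_solution hA hs
  refine ⟨K, hK, fun h hh ⟨M, hM⟩ => ?_⟩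
  obtain ⟨w, z, y, hw, hz, hy, heq, hwb⟩ := H (fun x => -h x) (⨆ y, ‖h y‖) hh.neg fun x => by
    rw [norm_neg]
    exact le_ciSup (f := fun y => ‖h y‖) ⟨M, by rintro _ ⟨y, rfl⟩; exact hM y⟩ x
  have hdw : deriv w = z := funext fun x => (hw x).deriv
  have hdz : deriv z = y := funext fun x => (hz x).deriv
  have huniq : ∀ w' : ℝ → Fin N → ℂ, (ContDiff ℝ 2 w' ∧ (∃ M, ∀ x, ‖w' x‖ ≤ M) ∧
      ∀ x : ℝ, A' *ᵥ deriv (deriv w') x + D *ᵥ deriv w' x + B' *ᵥ w' x - lam • w' x = -h x) →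
      w' = w := by
    rintro w' ⟨hc, ⟨b, hb⟩, he⟩
    obtain ⟨h1, h2⟩ := hd hc
    refine sub_eq_zero.mp (eq_zero_of_secondOrder_of_bounded hA hs
      (fun x => (h1 x).sub (hw x)) (fun x => (h2 x).sub (hz x)) (fun x => ?_)
      fun x => (norm_sub_le _ _).trans (add_le_add (hb x) (hwb x)))
    have h3 := congrArg₂ (· - ·) (he x) (heq x)
    simp only [sub_self, hBmul] at h3
    rw [← h3]
    simp only [mulVec_sub, hBmul, Pi.sub_apply, smul_sub]
    abel
  refine ⟨⟨w, ⟨?_, ⟨_, hwb⟩, fun x => ?_⟩, huniq⟩, fun w' hw' x => huniq w' hw' ▸ hwb x⟩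
  · rw [← one_add_one_eq_two, contDiff_succ_iff_deriv, hdw, contDiff_one_iff_deriv, hdz]
    exact ⟨fun x => (hw x).differentiableAt, fun h => by simp at h,
      fun x => (hz x).differentiableAt, hy⟩
  · rw [hdw, hdz, add_sub_assoc, ← hBmul]
    exact heq x
end

section
/- Let φ be a travelling-wave profile with speed c whose convergence to its limits is exponential: there are K, γ > 0 with |φ(x) − E⁺| + |φ'(x)| ≤ K e^{−γ x} for x ≥ 0 and |φ(x) − E⁻| + |φ'(x)| ≤ K e^{γ x} for x ≤ 0. Let λ ∈ ℂ be such that det(A μ² + (c·I + C⁺) μ + B⁺ − λ·I) ≠ 0 and det(A μ² + (c·I + C⁻) μ + B⁻ − λ·I) ≠ 0 for every purely imaginary μ ∈ ℂ. Then every bounded C² function ψ : ℝ → ℂ^N satisfying A ψ''(x) + c ψ'(x) + D_p f(φ(x), φ'(x)) ψ'(x) + D_u f(φ(x), φ'(x)) ψ(x) = λ ψ(x) for all x ∈ ℝ decays exponentially: there exist C₀, δ > 0 with |ψ(x)| + |ψ'(x)| ≤ C₀ e^{−δ |x|} for all x ∈ ℝ. -/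
open Matrix Filter Topology

section HalfLine

variable {E F : Type*} [NormedAddCommGroup E] [NormedAddCommGroup F]

/-- Exponential decay of a vector-valued function on the half-line `[0, ∞)`. -/
def ExpDecay (u : ℝ → E) : Prop :=
  ∃ C : ℝ, ∃ δ > (0 : ℝ), ∀ x : ℝ, 0 ≤ x → ‖u x‖ ≤ C * Real.exp (-δ * x)

lemma ExpDecay.of_norm_le {u : ℝ → E} {v : ℝ → F} (hv : ExpDecay v) (a : ℝ) (ha : 0 ≤ a)
    (h : ∀ x, 0 ≤ x → ‖u x‖ ≤ a * ‖v x‖) : ExpDecay u := by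
  obtain ⟨C, δ, hδ, hC⟩ := hv
  refine ⟨a * C, δ, hδ, fun x hx => (h x hx).trans ?_⟩
  rw [mul_assoc]
  exact mul_le_mul_of_nonneg_left (hC x hx) ha

lemma ExpDecay.const_nonneg {u : ℝ → E} {C δ : ℝ}
    (h : ∀ x : ℝ, 0 ≤ x → ‖u x‖ ≤ C * Real.exp (-δ * x)) : 0 ≤ C := by
  simpa using (norm_nonneg _).trans (h 0 le_rfl)

lemma exp_neg_mul_le_of_le {δ ε x : ℝ} (hx : 0 ≤ x) (h : ε ≤ δ) :
    Real.exp (-δ * x) ≤ Real.exp (-ε * x) :=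
  Real.exp_le_exp.2 (by nlinarith)

lemma ExpDecay.add {u v : ℝ → E} (hu : ExpDecay u) (hv : ExpDecay v) :
    ExpDecay (fun x => u x + v x) := by
  obtain ⟨C, δ, hδ, hC⟩ := hu
  obtain ⟨D, ε, hε, hD⟩ := hv
  refine ⟨C + D, min δ ε, lt_min hδ hε, fun x hx => (norm_add_le _ _).trans ?_⟩
  rw [add_mul]
  exact add_le_add
    ((hC x hx).trans (mul_le_mul_of_nonneg_left (exp_neg_mul_le_of_le hx (min_le_left _ _))
      (ExpDecay.const_nonneg hC)))
    ((hD x hx).trans (mul_le_mul_of_nonneg_left (exp_neg_mul_le_of_le hx (min_le_right _ _))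
      (ExpDecay.const_nonneg hD)))

lemma norm_sub_le_of_norm_deriv_le_exp [NormedSpace ℝ E] {u u' : ℝ → E} {C k : ℝ} (hk : k ≠ 0)
    (hu : ∀ x, 0 ≤ x → HasDerivAt u (u' x) x)
    (hu' : ∀ x, 0 ≤ x → ‖u' x‖ ≤ C * Real.exp (k * x)) {x y : ℝ} (hx : 0 ≤ x) (hxy : x ≤ y) :
    ‖u y - u x‖ ≤ C / k * (Real.exp (k * y) - Real.exp (k * x)) := by
  have hB : ∀ t, HasDerivAt (fun t => C / k * (Real.exp (k * t) - Real.exp (k * x)))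
      (C * Real.exp (k * t)) t := fun t => by
    have := ((((hasDerivAt_id t).const_mul k).exp).sub_const (Real.exp (k * x))).const_mul (C / k)
    refine this.congr_deriv ?_
    simp only [id]
    field_simp
  refine image_norm_le_of_norm_deriv_right_le_deriv_boundary
    (f := fun t => u t - u x) (f' := u') (a := x) (b := y)
    (fun t ht => ((hu t (hx.trans ht.1)).sub_const _).continuousAt.continuousWithinAt)
    (fun t ht => ((hu t (hx.trans ht.1)).sub_const _).hasDerivWithinAt)
    (by simp) hB (fun t ht => hu' t (hx.trans ht.1)) ⟨hxy, le_rfl⟩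

/-- Bounded solutions of `u' = μ u + g` with `Re μ ≠ 0` and exponentially decaying `g` decay
exponentially. -/
lemma ExpDecay.of_hasDerivAt_smul_add [NormedSpace ℂ E] {u g : ℝ → E} {μ : ℂ} (hμ : μ.re ≠ 0)
    (hu : ∀ x : ℝ, 0 ≤ x → HasDerivAt u (μ • u x + g x) x) (hg : ExpDecay g)
    {M : ℝ} (hM : ∀ x, 0 ≤ x → ‖u x‖ ≤ M) : ExpDecay u := by
  obtain ⟨C, δ₀, hδ₀, hC₀⟩ := hg
  have hC0 := ExpDecay.const_nonneg hC₀
  obtain ⟨δ, hδ, hδδ₀, hδμ⟩ : ∃ δ > 0, δ ≤ δ₀ ∧ δ < |μ.re| :=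
    ⟨min δ₀ (|μ.re| / 2), lt_min hδ₀ (by positivity), min_le_left _ _,
      (min_le_right _ _).trans_lt (half_lt_self (abs_pos.2 hμ))⟩
  have hC : ∀ x, 0 ≤ x → ‖g x‖ ≤ C * Real.exp (-δ * x) := fun x hx =>
    (hC₀ x hx).trans (mul_le_mul_of_nonneg_left (exp_neg_mul_le_of_le hx hδδ₀) hC0)
  set k : ℝ := -μ.re - δ with hk
  have hk0 : k ≠ 0 := by
    intro h
    have : μ.re = -δ := by linarith
    rw [this, abs_neg, abs_of_pos hδ] at hδμ
    exact lt_irrefl _ hδμ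
  set v : ℝ → E := fun x => Complex.exp (-μ * x) • u x with hv
  have hexp : ∀ x : ℝ, ‖Complex.exp (-μ * x)‖ = Real.exp (-μ.re * x) := fun x => by
    rw [Complex.norm_exp]; simp
  have hv' : ∀ x : ℝ, 0 ≤ x → HasDerivAt v (Complex.exp (-μ * x) • g x) x := fun x hx => by
    have h1 : HasDerivAt (fun x : ℝ => Complex.exp (-μ * x)) (Complex.exp (-μ * x) * -μ) x := by
      have := ((Complex.ofRealCLM.hasDerivAt (x := x)).const_mul (-μ)).cexp
      simpa using this
    refine (h1.smul (hu x hx)).congr_deriv ?_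
    module
  have hmain : ∀ x y, 0 ≤ x → x ≤ y →
      ‖v y - v x‖ ≤ C / k * (Real.exp (k * y) - Real.exp (k * x)) := fun x y hx hxy =>
    norm_sub_le_of_norm_deriv_le_exp hk0 hv' (fun t ht => by
      rw [norm_smul, hexp, hk, show (-μ.re - δ) * t = -μ.re * t + -δ * t by ring, Real.exp_add]
      calc _ ≤ Real.exp (-μ.re * t) * (C * Real.exp (-δ * t)) :=
            mul_le_mul_of_nonneg_left (hC t ht) (Real.exp_pos _).le
        _ = _ := by ring) hx hxy
  have hnv : ∀ x, ‖v x‖ = Real.exp (-μ.re * x) * ‖u x‖ := fun x => by rw [hv, norm_smul, hexp]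
  have hnu : ∀ x, ‖u x‖ = Real.exp (μ.re * x) * ‖v x‖ := fun x => by
    rw [hnv, ← mul_assoc, ← Real.exp_add]; simp
  have hcomb : ∀ x, Real.exp (μ.re * x) * Real.exp (k * x) = Real.exp (-δ * x) := fun x => by
    rw [← Real.exp_add, hk]; ring_nf
  rcases lt_or_gt_of_ne hμ with hneg | hpos
  · have hkpos : 0 < k := by rw [abs_of_neg hneg] at hδμ; linarith
    refine ⟨‖u 0‖ + C / k, δ, hδ, fun x hx => ?_⟩
    have h1 : ‖v x‖ ≤ ‖u 0‖ + C / k * Real.exp (k * x) := by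
      have h2 := hmain 0 x le_rfl hx
      have h3 : ‖v x‖ ≤ ‖v x - v 0‖ + ‖v 0‖ := by simpa using norm_add_le (v x - v 0) (v 0)
      have h4 : ‖v 0‖ = ‖u 0‖ := by rw [hnv]; simp
      have h5 : 0 ≤ C / k := by positivity
      simp only [mul_zero, Real.exp_zero] at h2
      nlinarith
    rw [hnu]
    calc _ ≤ Real.exp (μ.re * x) * (‖u 0‖ + C / k * Real.exp (k * x)) :=
          mul_le_mul_of_nonneg_left h1 (Real.exp_pos _).le
      _ = ‖u 0‖ * Real.exp (μ.re * x) + C / k * Real.exp (-δ * x) := by rw [← hcomb]; ring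
      _ ≤ ‖u 0‖ * Real.exp (-δ * x) + C / k * Real.exp (-δ * x) := by
          gcongr
          linarith
      _ = _ := by ring
  · have hkneg : k < 0 := by linarith
    refine ⟨C / -k, δ, hδ, fun x hx => ?_⟩
    have h1 : ‖v x‖ ≤ C / -k * Real.exp (k * x) := by
      have hle : ∀ y, x ≤ y → ‖v x‖ ≤ Real.exp (-μ.re * y) * M + C / -k * Real.exp (k * x) := by
        intro y hy
        have h2 := hmain x y hx hy
        have h3 : ‖v x‖ ≤ ‖v y‖ + ‖v y - v x‖ := by simpa using norm_sub_le (v y) (v y - v x)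
        have h4 : ‖v y‖ ≤ Real.exp (-μ.re * y) * M := by
          rw [hnv]; exact mul_le_mul_of_nonneg_left (hM y (hx.trans hy)) (Real.exp_pos _).le
        have h5 : 0 ≤ C / -k := div_nonneg hC0 (by linarith)
        have h6 : C / k = -(C / -k) := by rw [div_neg, neg_neg]
        rw [h6] at h2
        nlinarith [Real.exp_pos (k * y)]
      have hlim : Tendsto (fun y : ℝ => Real.exp (-μ.re * y) * M + C / -k * Real.exp (k * x)) atTop
          (𝓝 (0 * M + C / -k * Real.exp (k * x))) :=
        ((Real.tendsto_exp_atBot.comp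
          (tendsto_id.const_mul_atTop_of_neg (by linarith : -μ.re < 0))).mul_const M).add_const _
      rw [zero_mul, zero_add] at hlim
      exact ge_of_tendsto hlim (eventually_atTop.2 ⟨x, hle⟩)
    rw [hnu]
    calc _ ≤ Real.exp (μ.re * x) * (C / -k * Real.exp (k * x)) :=
          mul_le_mul_of_nonneg_left h1 (Real.exp_pos _).le
      _ = _ := by rw [← hcomb]; ring

/-- Bounded solutions of `u' = T u + g` with exponentially decaying `g` decay exponentially as soon
as `T` is annihilated by a product of linear factors with roots off the imaginary axis. -/
lemma ExpDecay.of_hasDerivAt_of_aeval_prod_eq_zero [NormedSpace ℂ E] [FiniteDimensional ℂ E]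
    (T : Module.End ℂ E) (s : Multiset ℂ) (hs : ∀ μ ∈ s, μ.re ≠ 0) {u g : ℝ → E}
    (hu : ∀ x : ℝ, 0 ≤ x → HasDerivAt u (T (u x) + g x) x) (hg : ExpDecay g)
    {M : ℝ} (hM : ∀ x, 0 ≤ x → ‖u x‖ ≤ M)
    (h0 : ∀ x, 0 ≤ x → Polynomial.aeval T
      (s.map fun μ => Polynomial.X - Polynomial.C μ).prod (u x) = 0) : ExpDecay u := by
  induction s using Multiset.induction_on generalizing u g M with
  | empty =>
    refine ⟨0, 1, one_pos, fun x hx => ?_⟩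
    have := h0 x hx
    simp only [Multiset.map_zero, Multiset.prod_zero, map_one, Module.End.one_apply] at this
    simp [this]
  | cons μ s ih =>
    let S : E →L[ℂ] E := LinearMap.toContinuousLinearMap (T - μ • 1)
    have hS : ∀ z, S z = T z - μ • z := fun z => by simp [S]
    have hdec : ExpDecay fun x => S (u x) := by
      refine ih (fun ν hν => hs ν (Multiset.mem_cons_of_mem hν)) (g := fun x => S (g x))
        (M := ‖S‖ * M) ?_ ?_ ?_ ?_
      · intro x hx
        refine ((S.restrictScalars ℝ).hasFDerivAt.comp_hasDerivAt x (hu x hx)).congr_deriv ?_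
        simp [hS]
        abel
      · exact hg.of_norm_le ‖S‖ (norm_nonneg _) fun x _ => S.le_opNorm _
      · exact fun x hx => (S.le_opNorm _).trans
          (mul_le_mul_of_nonneg_left (hM x hx) (norm_nonneg _))
      · intro x hx
        have := h0 x hx
        rw [Multiset.map_cons, Multiset.prod_cons, mul_comm, map_mul, Module.End.mul_apply] at this
        rw [hS]
        simpa [Algebra.algebraMap_eq_smul_one] using this
    refine ExpDecay.of_hasDerivAt_smul_add (hs μ (Multiset.mem_cons_self _ _))
      (g := fun x => S (u x) + g x) (fun x hx => ?_) (hdec.add hg) hM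
    refine (hu x hx).congr_deriv ?_
    rw [hS]
    abel

/-- Bounded solutions of `u' = T u + g` with `T` hyperbolic and `g` exponentially decaying decay
exponentially. -/
lemma ExpDecay.of_hasDerivAt_of_hyperbolic [NormedSpace ℂ E] [FiniteDimensional ℂ E]
    (T : Module.End ℂ E) (hT : ∀ μ, T.HasEigenvalue μ → μ.re ≠ 0) {u g : ℝ → E}
    (hu : ∀ x : ℝ, 0 ≤ x → HasDerivAt u (T (u x) + g x) x) (hg : ExpDecay g)
    {M : ℝ} (hM : ∀ x, 0 ≤ x → ‖u x‖ ≤ M) : ExpDecay u := by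
  have hmonic : (minpoly ℂ T).Monic := minpoly.monic (Algebra.IsIntegral.isIntegral T)
  refine ExpDecay.of_hasDerivAt_of_aeval_prod_eq_zero T (minpoly ℂ T).roots (fun μ hμ => ?_)
    hu hg hM fun x _ => ?_
  · exact hT μ (Module.End.hasEigenvalue_iff_isRoot.2 (Polynomial.isRoot_of_mem_roots hμ))
  · rw [← (IsAlgClosed.splits (minpoly ℂ T)).eq_prod_roots_of_monic hmonic, minpoly.aeval]
    rfl

/-- A bounded function on a half-line whose second derivative grows at most linearly in the first
derivative has a bounded first derivative. -/
lemma exists_norm_deriv_le_of_bounded [NormedSpace ℝ E] {u v w : ℝ → E} {M L L₀ : ℝ} (hL : 0 < L)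
    (hL₀ : 0 ≤ L₀)
    (hu : ∀ x, 0 ≤ x → HasDerivAt u (v x) x) (hv : ∀ x, 0 ≤ x → HasDerivAt v (w x) x)
    (hM : ∀ x, 0 ≤ x → ‖u x‖ ≤ M) (hw : ∀ x, 0 ≤ x → ‖w x‖ ≤ L * ‖v x‖ + L₀) :
    ∃ R, ∀ x, 0 ≤ x → ‖v x‖ ≤ R := by
  refine ⟨16 * L * M + L₀ / L, fun x hx => ?_⟩
  set h : ℝ := 1 / (4 * L) with hh
  have hhpos : 0 < h := by positivity
  have hLh : L * h = 1 / 4 := by rw [hh]; field_simp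
  have hosc : ∀ y ∈ Set.Icc x (x + h), ‖v y - v x‖ ≤ (‖v x‖ + L₀ / L) / 2 := by
    intro y hy
    have hg := norm_le_gronwallBound_of_norm_deriv_right_le (f := fun t => v t - v x) (f' := w)
      (δ := 0) (K := L) (ε := L * ‖v x‖ + L₀) (a := x) (b := x + h)
      (fun t ht => ((hv t (hx.trans ht.1)).sub_const _).continuousAt.continuousWithinAt)
      (fun t ht => ((hv t (hx.trans ht.1)).sub_const _).hasDerivWithinAt) (by simp)
      (fun t ht => by
        have h1 : ‖v t‖ ≤ ‖v t - v x‖ + ‖v x‖ := by simpa using norm_add_le (v t - v x) (v x)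
        have h2 := hw t (hx.trans ht.1)
        nlinarith) y hy
    rw [gronwallBound_of_K_ne_0 hL.ne'] at hg
    have h1 : Real.exp (L * (y - x)) ≤ 3 / 2 := by
      have h2 : Real.exp (L * (y - x)) ≤ Real.exp (1 / 4) :=
        Real.exp_le_exp.2 (by rw [← hLh]; exact mul_le_mul_of_nonneg_left (by linarith [hy.2]) hL.le)
      have h3 : Real.exp (1 / 4) ≤ 1 / (1 - 1 / 4) :=
        Real.exp_bound_div_one_sub_of_interval (by norm_num) (by norm_num)
      rw [show (1 : ℝ) / (1 - 1 / 4) = 4 / 3 by norm_num] at h3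
      linarith
    have h4 : (L * ‖v x‖ + L₀) / L = ‖v x‖ + L₀ / L := by field_simp
    rw [h4] at hg
    have h5 : 0 ≤ ‖v x‖ + L₀ / L := by positivity
    simp only [zero_mul, zero_add] at hg
    nlinarith
  have hseg := norm_image_sub_le_of_norm_deriv_right_le_segment
    (f := fun t => u t - t • v x) (f' := fun t => v t - v x) (a := x) (b := x + h)
    (C := (‖v x‖ + L₀ / L) / 2)
    (fun t ht => ((hu t (hx.trans ht.1)).sub
      ((hasDerivAt_id t).smul_const (v x))).continuousAt.continuousWithinAt)
    (fun t ht => by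
      have := ((hu t (hx.trans ht.1)).sub ((hasDerivAt_id t).smul_const (v x)))
      rw [one_smul] at this
      exact this.hasDerivWithinAt)
    (fun t ht => hosc t ⟨ht.1, ht.2.le⟩) (x + h) ⟨by linarith, le_rfl⟩
  have hsplit : h • v x = (u (x + h) - u x) - ((u (x + h) - (x + h) • v x) - (u x - x • v x)) := by
    module
  have hnorm : h * ‖v x‖ ≤ 2 * M + (‖v x‖ + L₀ / L) / 2 * h := by
    have h1 : h * ‖v x‖ = ‖h • v x‖ := by rw [norm_smul, Real.norm_of_nonneg hhpos.le]
    rw [h1, hsplit]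
    refine (norm_sub_le _ _).trans (add_le_add ((norm_sub_le _ _).trans ?_) ?_)
    · linarith [hM x hx, hM (x + h) (by linarith)]
    · simpa using hseg
  have hfin : L * (h * ‖v x‖) ≤ L * (2 * M + (‖v x‖ + L₀ / L) / 2 * h) :=
    mul_le_mul_of_nonneg_left hnorm hL.le
  have e1 : L * (h * ‖v x‖) = ‖v x‖ / 4 := by rw [← mul_assoc, hLh]; ring
  have e2 : L * (2 * M + (‖v x‖ + L₀ / L) / 2 * h) = 2 * L * M + (‖v x‖ + L₀ / L) / 8 := by
    linear_combination (‖v x‖ + L₀ / L) / 2 * hLh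
  rw [e1, e2] at hfin
  linarith

end HalfLine

section SecondOrder

variable {ι : Type*} [Fintype ι]

lemma norm_mulVec_le_of_entry_le {D : Matrix ι ι ℂ} {ε : ℝ} (hε : 0 ≤ ε)
    (hD : ∀ i j, ‖D i j‖ ≤ ε) (z : ι → ℂ) : ‖D *ᵥ z‖ ≤ Fintype.card ι * ε * ‖z‖ := by
  refine (pi_norm_le_iff_of_nonneg (by positivity)).2 fun i => ?_
  calc ‖∑ j, D i j * z j‖ ≤ ∑ j, ‖D i j * z j‖ := norm_sum_le _ _
    _ ≤ ∑ _j : ι, ε * ‖z‖ := by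
      refine Finset.sum_le_sum fun j _ => ?_
      rw [norm_mul]
      exact mul_le_mul (hD i j) (norm_le_pi_norm z j) (norm_nonneg _) hε
    _ = _ := by simp [mul_assoc]

lemma exists_norm_mulVec_le (D : Matrix ι ι ℂ) : ∃ a, 0 ≤ a ∧ ∀ z, ‖D *ᵥ z‖ ≤ a * ‖z‖ :=
  ⟨‖LinearMap.toContinuousLinearMap D.mulVecLin‖, norm_nonneg _, fun z =>
    (LinearMap.toContinuousLinearMap D.mulVecLin).le_opNorm z⟩

variable [DecidableEq ι]

/-- Bounded solutions on `[0, ∞)` of an asymptotically constant second order linear system whose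
limiting characteristic polynomial has no purely imaginary roots decay exponentially. -/
lemma expDecay_of_second_order (A P₀ Q₀ : Matrix ι ι ℂ) (P Q : ℝ → Matrix ι ι ℂ)
    (hA : IsUnit A.det) (hdet : ∀ μ : ℂ, μ.re = 0 → (μ ^ 2 • A + μ • P₀ + Q₀).det ≠ 0)
    {κ γ : ℝ} (hκ : 0 ≤ κ) (hγ : 0 < γ)
    (hP : ∀ x, 0 ≤ x → ∀ i j, ‖P x i j - P₀ i j‖ ≤ κ * Real.exp (-γ * x))
    (hQ : ∀ x, 0 ≤ x → ∀ i j, ‖Q x i j - Q₀ i j‖ ≤ κ * Real.exp (-γ * x))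
    {u v w : ℝ → ι → ℂ} {M : ℝ}
    (hu : ∀ x, 0 ≤ x → HasDerivAt u (v x) x) (hv : ∀ x, 0 ≤ x → HasDerivAt v (w x) x)
    (hode : ∀ x, 0 ≤ x → A *ᵥ w x + P x *ᵥ v x + Q x *ᵥ u x = 0)
    (hM : ∀ x, 0 ≤ x → ‖u x‖ ≤ M) : ExpDecay fun x => (u x, v x) := by
  obtain ⟨a, ha, hAinv⟩ := exists_norm_mulVec_le A⁻¹
  obtain ⟨p, hp, hP₀⟩ := exists_norm_mulVec_le P₀
  obtain ⟨q, hq, hQ₀⟩ := exists_norm_mulVec_le Q₀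
  have hM0 : 0 ≤ M := (norm_nonneg _).trans (hM 0 le_rfl)
  set n : ℝ := (Fintype.card ι : ℝ)
  have hn0 : 0 ≤ n := Nat.cast_nonneg _
  set r : ℝ → ι → ℂ := fun x => -(A⁻¹ *ᵥ ((P x - P₀) *ᵥ v x + (Q x - Q₀) *ᵥ u x)) with hr
  have hw : ∀ x, 0 ≤ x → w x = -(A⁻¹ *ᵥ (P₀ *ᵥ v x + Q₀ *ᵥ u x)) + r x := fun x hx => by
    have h1 : A *ᵥ w x = -(P x *ᵥ v x + Q x *ᵥ u x) := by
      rw [eq_neg_iff_add_eq_zero, ← add_assoc]; exact hode x hx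
    have h2 : w x = A⁻¹ *ᵥ (A *ᵥ w x) := by
      rw [mulVec_mulVec, nonsing_inv_mul A hA, one_mulVec]
    rw [h2, h1, hr, ← neg_add, ← mulVec_add, mulVec_neg]
    congr 2
    rw [sub_mulVec, sub_mulVec]
    abel
  have hrle : ∀ x, 0 ≤ x →
      ‖r x‖ ≤ a * (n * (κ * Real.exp (-γ * x)) * ‖v x‖ + n * (κ * Real.exp (-γ * x)) * ‖u x‖) := by
    intro x hx
    rw [hr, norm_neg]
    refine (hAinv _).trans (mul_le_mul_of_nonneg_left ((norm_add_le _ _).trans ?_) ha)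
    exact add_le_add (norm_mulVec_le_of_entry_le (by positivity) (hP x hx) _)
      (norm_mulVec_le_of_entry_le (by positivity) (hQ x hx) _)
  have hwle : ∀ x, 0 ≤ x →
      ‖w x‖ ≤ (a * p + a * (n * κ) + 1) * ‖v x‖ + (a * q * M + a * (n * κ) * M) := by
    intro x hx
    have he : Real.exp (-γ * x) ≤ 1 := Real.exp_le_one_iff.2 (by nlinarith)
    have h1 : ‖A⁻¹ *ᵥ (P₀ *ᵥ v x + Q₀ *ᵥ u x)‖ ≤ a * (p * ‖v x‖ + q * M) :=
      (hAinv _).trans (mul_le_mul_of_nonneg_left ((norm_add_le _ _).trans (add_le_add (hP₀ _)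
        ((hQ₀ _).trans (mul_le_mul_of_nonneg_left (hM x hx) hq)))) ha)
    have h2 : ‖r x‖ ≤ a * (n * (κ * 1) * ‖v x‖ + n * (κ * 1) * M) := by
      refine (hrle x hx).trans ?_
      have := hM x hx
      gcongr
    rw [hw x hx]
    have h3 := norm_add_le (-(A⁻¹ *ᵥ (P₀ *ᵥ v x + Q₀ *ᵥ u x))) (r x)
    rw [norm_neg] at h3
    nlinarith [norm_nonneg (v x)]
  obtain ⟨R, hR⟩ := exists_norm_deriv_le_of_bounded (by positivity) (by positivity) hu hv hM hwle
  have hR0 : 0 ≤ R := (norm_nonneg _).trans (hR 0 le_rfl)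
  let T : Module.End ℂ ((ι → ℂ) × (ι → ℂ)) :=
    (LinearMap.snd ℂ _ _).prod
      (-(A⁻¹.mulVecLin ∘ₗ (P₀.mulVecLin ∘ₗ LinearMap.snd ℂ _ _ +
        Q₀.mulVecLin ∘ₗ LinearMap.fst ℂ _ _)))
  have hT : ∀ z, T z = (z.2, -(A⁻¹ *ᵥ (P₀ *ᵥ z.2 + Q₀ *ᵥ z.1))) := fun z => rfl
  refine ExpDecay.of_hasDerivAt_of_hyperbolic T (fun μ hμ hre => ?_) (g := fun x => (0, r x))
    (M := max M R) (fun x hx => ?_) ?_ fun x hx => ?_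
  · obtain ⟨z, hz⟩ := hμ.exists_hasEigenvector
    have hz1 := hz.apply_eq_smul
    rw [hT, Prod.ext_iff] at hz1
    obtain ⟨h1, h2⟩ := hz1
    simp only [Prod.smul_fst, Prod.smul_snd] at h1 h2
    rw [h1] at h2
    refine hdet μ hre (Matrix.exists_mulVec_eq_zero_iff.1 ⟨z.1, fun h0 => hz.2 ?_, ?_⟩)
    · exact Prod.ext h0 (by rw [h1, h0, smul_zero]; rfl)
    · have h3 : A *ᵥ (A⁻¹ *ᵥ (P₀ *ᵥ (μ • z.1) + Q₀ *ᵥ z.1)) = P₀ *ᵥ (μ • z.1) + Q₀ *ᵥ z.1 := by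
        rw [mulVec_mulVec, mul_nonsing_inv A hA, one_mulVec]
      rw [neg_eq_iff_eq_neg.1 h2, mulVec_neg, mulVec_smul, mulVec_smul, mulVec_smul] at h3
      rw [add_mulVec, add_mulVec, smul_mulVec, smul_mulVec, add_assoc, ← h3]
      module
  · refine ((hu x hx).prodMk (hv x hx)).congr_deriv ?_
    rw [hT, Prod.mk_add_mk, add_zero, ← hw x hx]
  · refine ⟨a * (n * κ * R + n * κ * M), γ, hγ, fun x hx => ?_⟩
    rw [Prod.norm_mk, norm_zero, max_eq_right (norm_nonneg _)]
    refine (hrle x hx).trans ?_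
    have h1 := hM x hx
    have h2 := hR x hx
    calc _ ≤ a * (n * (κ * Real.exp (-γ * x)) * R + n * (κ * Real.exp (-γ * x)) * M) := by gcongr
      _ = _ := by ring
  · exact max_le_max (hM x hx) (hR x hx)

end SecondOrder

lemma Dp_apply_eq_fderiv {N : ℕ} {f : (Fin N → ℝ) → (Fin N → ℝ) → Fin N → ℝ}
    (hf : Differentiable ℝ (fun q : (Fin N → ℝ) × (Fin N → ℝ) => f q.1 q.2))
    (u p : Fin N → ℝ) (i j : Fin N) :
    Dp f u p i j = fderiv ℝ (fun q : (Fin N → ℝ) × (Fin N → ℝ) => f q.1 q.2) (u, p)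
      (0, Pi.single j 1) i := by
  have h1 := (hf (u, p)).hasFDerivAt.comp p (hasFDerivAt_prodMk_right u p)
  have h2 := (hasFDerivAt_pi'.1 h1 i).fderiv
  simp only [Function.comp_def] at h2
  rw [Dp, h2]
  simp

lemma Du_apply_eq_fderiv {N : ℕ} {f : (Fin N → ℝ) → (Fin N → ℝ) → Fin N → ℝ}
    (hf : Differentiable ℝ (fun q : (Fin N → ℝ) × (Fin N → ℝ) => f q.1 q.2))
    (u p : Fin N → ℝ) (i j : Fin N) :
    Du f u p i j = fderiv ℝ (fun q : (Fin N → ℝ) × (Fin N → ℝ) => f q.1 q.2) (u, p)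
      (Pi.single j 1, 0) i := by
  have h1 := HasFDerivAt.comp (f := fun e => (e, p)) u (hf (u, p)).hasFDerivAt
    (hasFDerivAt_prodMk_left u p)
  have h2 := (hasFDerivAt_pi'.1 h1 i).fderiv
  simp only [Function.comp_def] at h2
  rw [Du, h2]
  simp

/-- On bounded sets the entries of both Jacobians are Lipschitz in the base point. -/
lemma exists_jacobian_sub_le {N : ℕ} {f : (Fin N → ℝ) → (Fin N → ℝ) → Fin N → ℝ}
    (hf : ContDiff ℝ 1 (fun q : (Fin N → ℝ) × (Fin N → ℝ) => f q.1 q.2))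
    (hfLip : ∀ K : Set ((Fin N → ℝ) × (Fin N → ℝ)), IsCompact K → ∃ L : NNReal,
      LipschitzOnWith L (fderiv ℝ (fun q : (Fin N → ℝ) × (Fin N → ℝ) => f q.1 q.2)) K) (R : ℝ) :
    ∃ L : ℝ, 0 ≤ L ∧ ∀ u p e : Fin N → ℝ, ‖u‖ ≤ R → ‖p‖ ≤ R → ‖e‖ ≤ R → ∀ i j,
      |Dp f u p i j - Dp f e 0 i j| ≤ L * (‖u - e‖ + ‖p‖) ∧
      |Du f u p i j - Du f e 0 i j| ≤ L * (‖u - e‖ + ‖p‖) := by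
  have hd := hf.differentiable one_ne_zero
  obtain ⟨L, hL⟩ := hfLip (Metric.closedBall 0 R) (isCompact_closedBall _ _)
  refine ⟨L, L.2, fun u p e hu hp he i j => ?_⟩
  have hmem : (u, p) ∈ Metric.closedBall (0 : (Fin N → ℝ) × (Fin N → ℝ)) R := by
    simpa [Prod.norm_def] using ⟨hu, hp⟩
  have hmem' : (e, 0) ∈ Metric.closedBall (0 : (Fin N → ℝ) × (Fin N → ℝ)) R := by
    simpa [Prod.norm_def] using he
  have hle := hL.norm_sub_le hmem hmem'
  have hprod : ‖(u, p) - (e, 0)‖ ≤ ‖u - e‖ + ‖p‖ := by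
    rw [Prod.mk_sub_mk, sub_zero, Prod.norm_mk]
    exact max_le_add_of_nonneg (norm_nonneg _) (norm_nonneg _)
  have key : ∀ z : (Fin N → ℝ) × (Fin N → ℝ), ‖z‖ ≤ 1 →
      |fderiv ℝ (fun q : (Fin N → ℝ) × (Fin N → ℝ) => f q.1 q.2) (u, p) z i -
        fderiv ℝ (fun q : (Fin N → ℝ) × (Fin N → ℝ) => f q.1 q.2) (e, 0) z i| ≤
      L * (‖u - e‖ + ‖p‖) := by
    intro z hz
    rw [← Pi.sub_apply, ← _root_.sub_apply, ← Real.norm_eq_abs]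
    refine (norm_le_pi_norm _ i).trans ((ContinuousLinearMap.le_of_opNorm_le _ hle _).trans ?_)
    calc _ ≤ (L : ℝ) * ‖(u, p) - (e, 0)‖ * 1 := by gcongr
      _ ≤ _ := by rw [mul_one]; gcongr
  constructor
  · rw [Dp_apply_eq_fderiv hd, Dp_apply_eq_fderiv hd]
    exact key _ (by simp [Prod.norm_def, Pi.norm_single])
  · rw [Du_apply_eq_fderiv hd, Du_apply_eq_fderiv hd]
    exact key _ (by simp [Prod.norm_def, Pi.norm_single])

/-- for an exponentially convergent travelling wave φ and a
λ ∈ ℂ off the purely-imaginary characteristic curves at ±∞, every bounded C²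
solution ψ of the eigenvalue equation for the linearization about φ decays
exponentially, together with its derivative, as |x| → ∞. -/
theorem bounded_eigenfunctions_decay_exponentially
    (N : ℕ) (hN : 1 ≤ N)
    (A : Matrix (Fin N) (Fin N) ℝ)
    (hAdiag : ∀ i j, i ≠ j → A i j = 0) (hApos : ∀ i, 0 < A i i)
    (f : (Fin N → ℝ) → (Fin N → ℝ) → Fin N → ℝ)
    (hf : ContDiff ℝ 1 (fun q : (Fin N → ℝ) × (Fin N → ℝ) => f q.1 q.2))
    (hfLip : ∀ K : Set ((Fin N → ℝ) × (Fin N → ℝ)), IsCompact K → ∃ L : NNReal,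
      LipschitzOnWith L (fderiv ℝ (fun q : (Fin N → ℝ) × (Fin N → ℝ) => f q.1 q.2)) K)
    (c : ℝ) (φ : ℝ → Fin N → ℝ)
    (hφC2 : ContDiff ℝ 2 φ)
    (hφbdd : ∃ M, ∀ x, ‖φ x‖ ≤ M ∧ ‖deriv φ x‖ ≤ M)
    (heq : ∀ x, A.mulVec (deriv (deriv φ) x) + c • deriv φ x
      + f (φ x) (deriv φ x) = 0)
    (Em Ep : Fin N → ℝ) (hne : Em ≠ Ep)
    (hlimp : Tendsto φ atTop (𝓝 Ep)) (hlimm : Tendsto φ atBot (𝓝 Em))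
    (K γ : ℝ) (hK : 0 < K) (hγ : 0 < γ)
    (hexpP : ∀ x : ℝ, 0 ≤ x →
      ‖φ x - Ep‖ + ‖deriv φ x‖ ≤ K * Real.exp (-γ * x))
    (hexpM : ∀ x : ℝ, x ≤ 0 →
      ‖φ x - Em‖ + ‖deriv φ x‖ ≤ K * Real.exp (γ * x))
    (lam : ℂ)
    (hlamP : ∀ μ : ℂ, μ.re = 0 →
      (μ ^ 2 • A.map Complex.ofReal
        + μ • ((c : ℂ) • (1 : Matrix (Fin N) (Fin N) ℂ)
            + (Dp f Ep 0).map Complex.ofReal)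
        + (Du f Ep 0).map Complex.ofReal
        - lam • (1 : Matrix (Fin N) (Fin N) ℂ)).det ≠ 0)
    (hlamM : ∀ μ : ℂ, μ.re = 0 →
      (μ ^ 2 • A.map Complex.ofReal
        + μ • ((c : ℂ) • (1 : Matrix (Fin N) (Fin N) ℂ)
            + (Dp f Em 0).map Complex.ofReal)
        + (Du f Em 0).map Complex.ofReal
        - lam • (1 : Matrix (Fin N) (Fin N) ℂ)).det ≠ 0)
    (ψ : ℝ → Fin N → ℂ)
    (hψC2 : ContDiff ℝ 2 ψ)
    (hψbdd : ∃ M, ∀ x, ‖ψ x‖ ≤ M)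
    (hψeq : ∀ x : ℝ,
      (A.map Complex.ofReal).mulVec (deriv (deriv ψ) x)
        + (c : ℂ) • deriv ψ x
        + ((Dp f (φ x) (deriv φ x)).map Complex.ofReal).mulVec (deriv ψ x)
        + ((Du f (φ x) (deriv φ x)).map Complex.ofReal).mulVec (ψ x)
        = lam • ψ x) :
    ∃ C₀ > (0 : ℝ), ∃ δ > (0 : ℝ), ∀ x : ℝ,
      ‖ψ x‖ + ‖deriv ψ x‖ ≤ C₀ * Real.exp (-δ * |x|) := by
  obtain ⟨R, hR⟩ := hφbdd
  obtain ⟨M, hM⟩ := hψbdd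
  obtain ⟨L, hL, hjac⟩ := exists_jacobian_sub_le hf hfLip R
  have hEp : ‖Ep‖ ≤ R := le_of_tendsto hlimp.norm (Eventually.of_forall fun x => (hR x).1)
  have hEm : ‖Em‖ ≤ R := le_of_tendsto hlimm.norm (Eventually.of_forall fun x => (hR x).1)
  have hψ1 : ∀ x, HasDerivAt ψ (deriv ψ x) x := fun x =>
    (hψC2.differentiable two_ne_zero x).hasDerivAt
  have hψ2 : ∀ x, HasDerivAt (deriv ψ) (deriv (deriv ψ) x) x := fun x =>
    ((hψC2.iterate_deriv' 1 1).differentiable one_ne_zero x).hasDerivAt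
  have hA : IsUnit (A.map Complex.ofReal).det := by
    have hdiag : A.map Complex.ofReal = diagonal fun i => (A i i : ℂ) := by
      ext i j
      rcases eq_or_ne i j with rfl | hij
      · simp
      · simp [hij, hAdiag i j hij]
    rw [hdiag, det_diagonal, isUnit_iff_ne_zero, Finset.prod_ne_zero_iff]
    exact fun i _ => Complex.ofReal_ne_zero.2 (hApos i).ne'
  have hplus : ExpDecay fun x => (ψ x, deriv ψ x) := by
    refine expDecay_of_second_order (A.map Complex.ofReal)
      ((c : ℂ) • 1 + (Dp f Ep 0).map Complex.ofReal) ((Du f Ep 0).map Complex.ofReal - lam • 1)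
      (fun x => (c : ℂ) • 1 + (Dp f (φ x) (deriv φ x)).map Complex.ofReal)
      (fun x => (Du f (φ x) (deriv φ x)).map Complex.ofReal - lam • 1)
      hA (fun μ hμ => ?_) (mul_nonneg hL hK.le) hγ (fun x hx i j => ?_) (fun x hx i j => ?_)
      (fun x _ => hψ1 x) (fun x _ => hψ2 x) (fun x _ => ?_) (fun x _ => hM x)
    · rw [← add_sub_assoc]
      exact hlamP μ hμ
    · rw [mul_assoc]
      refine le_trans ?_ (mul_le_mul_of_nonneg_left (hexpP x hx) hL)
      simpa [← Complex.ofReal_sub] using (hjac _ _ Ep (hR x).1 (hR x).2 hEp i j).1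
    · rw [mul_assoc]
      refine le_trans ?_ (mul_le_mul_of_nonneg_left (hexpP x hx) hL)
      simpa [← Complex.ofReal_sub] using (hjac _ _ Ep (hR x).1 (hR x).2 hEp i j).2
    · rw [add_mulVec, sub_mulVec, smul_mulVec, smul_mulVec, one_mulVec, one_mulVec, ← hψeq x]
      abel
  have hminus : ExpDecay fun x => (ψ (-x), -deriv ψ (-x)) := by
    refine expDecay_of_second_order (w := fun x => deriv (deriv ψ) (-x)) (A.map Complex.ofReal)
      (-((c : ℂ) • 1 + (Dp f Em 0).map Complex.ofReal)) ((Du f Em 0).map Complex.ofReal - lam • 1)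
      (fun x => -((c : ℂ) • 1 + (Dp f (φ (-x)) (deriv φ (-x))).map Complex.ofReal))
      (fun x => (Du f (φ (-x)) (deriv φ (-x))).map Complex.ofReal - lam • 1)
      hA (fun μ hμ => ?_) (mul_nonneg hL hK.le) hγ (fun x hx i j => ?_) (fun x hx i j => ?_)
      (fun x _ => ?_) (fun x _ => ?_) (fun x _ => ?_) (fun x _ => hM (-x))
    · have h := hlamM (-μ) (by simp [hμ])
      rwa [neg_sq, neg_smul, ← smul_neg, add_sub_assoc] at h
    · rw [mul_assoc]
      have h := hexpM (-x) (by linarith)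
      rw [mul_neg, ← neg_mul] at h
      refine le_trans ?_ (mul_le_mul_of_nonneg_left h hL)
      have h1 := (hjac _ _ Em (hR (-x)).1 (hR (-x)).2 hEm i j).1
      rw [neg_apply, neg_apply, neg_sub_neg, norm_sub_rev]
      simpa [← Complex.ofReal_sub] using h1
    · rw [mul_assoc]
      have h := hexpM (-x) (by linarith)
      rw [mul_neg, ← neg_mul] at h
      refine le_trans ?_ (mul_le_mul_of_nonneg_left h hL)
      simpa [← Complex.ofReal_sub] using (hjac _ _ Em (hR (-x)).1 (hR (-x)).2 hEm i j).2
    · exact ((hψ1 (-x)).scomp x (hasDerivAt_neg x)).congr_deriv (by simp)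
    · exact ((hψ2 (-x)).scomp x (hasDerivAt_neg x)).neg.congr_deriv (by simp)
    · rw [neg_mulVec_neg, add_mulVec, sub_mulVec, smul_mulVec, smul_mulVec, one_mulVec, one_mulVec,
        ← hψeq (-x)]
      abel
  obtain ⟨C, δ, hδ, hC⟩ := hplus
  obtain ⟨D, ε, hε, hD⟩ := hminus
  have hC0 := ExpDecay.const_nonneg hC
  have hD0 := ExpDecay.const_nonneg hD
  refine ⟨2 * (C + D) + 1, by positivity, min δ ε, lt_min hδ hε, fun x => ?_⟩
  have hfinal : ∀ {S η : ℝ}, 0 ≤ S → S ≤ C + D → min δ ε ≤ η → ‖ψ x‖ ≤ S * Real.exp (-η * |x|) →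
      ‖deriv ψ x‖ ≤ S * Real.exp (-η * |x|) →
      ‖ψ x‖ + ‖deriv ψ x‖ ≤ (2 * (C + D) + 1) * Real.exp (-min δ ε * |x|) := by
    intro S η hS hSCD hη h1 h2
    have h3 : S * Real.exp (-η * |x|) ≤ (C + D) * Real.exp (-min δ ε * |x|) :=
      mul_le_mul hSCD (exp_neg_mul_le_of_le (abs_nonneg x) hη) (Real.exp_pos _).le (by positivity)
    nlinarith [Real.exp_pos (-min δ ε * |x|)]
  rcases le_total 0 x with hx | hx
  · have h := hC x hx
    refine hfinal hC0 (by linarith) (min_le_left _ _) ?_ ?_ <;> rw [abs_of_nonneg hx]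
    · exact (norm_fst_le _).trans h
    · exact (norm_snd_le _).trans h
  · have h := hD (-x) (by linarith)
    simp only [neg_neg] at h
    refine hfinal hD0 (by linarith) (min_le_right _ _) ?_ ?_ <;> rw [abs_of_nonpos hx]
    · exact (norm_fst_le _).trans h
    · exact (norm_neg (deriv ψ x)).symm.le.trans ((norm_snd_le _).trans h)
end

section
/- Let u be a bounded classical solution of the linear parabolic system v_t = A v_xx + C(x) v_x + B(x) v on ℝ × (0, T], where B, C : ℝ → ℝ^{N×N} are bounded continuous matrix-valued functions, with bounded continuous initial datum v₀. Then there exists a constant M > 0, depending only on A and the sup-norms of B and C, such that sup_x |v_x(x, t)| ≤ M t^{−1/2} e^{M t} · sup_x |v₀(x)| for all t ∈ (0, T]. (Parabolic smoothing: the solution semigroup maps bounded continuous data into C¹ with a t^{−1/2} gradient bound.) -/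
open Matrix Filter Topology

/-- Second derivative test: the second derivative is nonpositive at a local maximum. -/
theorem IsLocalMax.deriv_deriv_nonpos {f : ℝ → ℝ} {x : ℝ} (h : IsLocalMax f x)
    (hc : ContinuousAt f x) : deriv (deriv f) x ≤ 0 := by
  by_contra! hpos
  have hmin : IsLocalMin f x := isLocalMin_of_deriv_deriv_pos hpos h.deriv_eq_zero hc
  have heq : f =ᶠ[𝓝 x] fun _ => f x := by
    filter_upwards [h, hmin] with y h₁ h₂
    exact le_antisymm h₁ h₂
  have h2 : deriv f =ᶠ[𝓝 x] fun _ => 0 := by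
    simpa using heq.deriv
  rw [h2.deriv_eq] at hpos
  simp at hpos

/-- A derivative is nonnegative at a point where the function is maximal from the left. -/
theorem HasDerivAt.nonneg_of_forall_le_left {f : ℝ → ℝ} {f' s t : ℝ} (hst : s < t)
    (hf : HasDerivAt f f' t) (hle : ∀ r ∈ Set.Icc s t, f r ≤ f t) : 0 ≤ f' := by
  refine ge_of_tendsto (hasDerivAt_iff_tendsto_slope_left_right.1 hf).1 ?_
  filter_upwards [Ioo_mem_nhdsLT hst] with r hr
  rw [slope_def_field]
  exact div_nonneg_of_nonpos (sub_nonpos.2 (hle r ⟨hr.1.le, hr.2.le⟩)) (sub_nonpos.2 hr.2.le)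

/-- Space-time regularity of a scalar classical solution on `ℝ × (s, t]`. -/
structure IsClassicalOn (f : ℝ → ℝ → ℝ) (s t : ℝ) : Prop where
  continuousOn : ContinuousOn (fun q : ℝ × ℝ => f q.1 q.2) (Set.univ ×ˢ Set.Icc s t)
  differentiableAt : ∀ x, ∀ r ∈ Set.Ioc s t, DifferentiableAt ℝ (fun r => f x r) r
  contDiff : ∀ r ∈ Set.Ioc s t, ContDiff ℝ 2 (fun y => f y r)

namespace IsClassicalOn

variable {f : ℝ → ℝ → ℝ} {s t : ℝ}

theorem mono (h : IsClassicalOn f s t) {s' t' : ℝ} (hs : s ≤ s') (ht : t' ≤ t) :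
    IsClassicalOn f s' t' where
  continuousOn := h.continuousOn.mono (Set.prod_mono_right (Set.Icc_subset_Icc hs ht))
  differentiableAt x r hr := h.differentiableAt x r (Set.Ioc_subset_Ioc hs ht hr)
  contDiff r hr := h.contDiff r (Set.Ioc_subset_Ioc hs ht hr)

theorem neg (h : IsClassicalOn f s t) : IsClassicalOn (fun x r => -f x r) s t where
  continuousOn := h.continuousOn.neg
  differentiableAt x r hr := (h.differentiableAt x r hr).neg
  contDiff r hr := (h.contDiff r hr).neg

theorem sub_reflect (h : IsClassicalOn f s t) (x : ℝ) :
    IsClassicalOn (fun y r => f (x + y) r - f (x - y) r) s t where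
  continuousOn := by
    refine ContinuousOn.sub ?_ ?_
    · exact h.continuousOn.comp (f := fun q : ℝ × ℝ => (x + q.1, q.2)) (by fun_prop)
        (fun q hq => ⟨trivial, hq.2⟩)
    · exact h.continuousOn.comp (f := fun q : ℝ × ℝ => (x - q.1, q.2)) (by fun_prop)
        (fun q hq => ⟨trivial, hq.2⟩)
  differentiableAt y r hr := (h.differentiableAt _ r hr).sub (h.differentiableAt _ r hr)
  contDiff r hr := by
    have h2 := h.contDiff r hr
    exact (h2.comp (contDiff_const.add contDiff_id)).sub (h2.comp (contDiff_const.sub contDiff_id))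

theorem differentiable (h : IsClassicalOn f s t) {r : ℝ} (hr : r ∈ Set.Ioc s t) :
    Differentiable ℝ (fun y => f y r) :=
  (h.contDiff r hr).differentiable (by norm_num)

theorem differentiable_deriv (h : IsClassicalOn f s t) {r : ℝ} (hr : r ∈ Set.Ioc s t) :
    Differentiable ℝ (deriv fun y => f y r) :=
  ((contDiff_succ_iff_deriv (n := 1)).1 (h.contDiff r hr)).2.2.differentiable (by norm_num)

theorem deriv_deriv_sub_reflect (h : IsClassicalOn f s t) {r : ℝ} (hr : r ∈ Set.Ioc s t)
    (x y : ℝ) : deriv (deriv fun y => f (x + y) r - f (x - y) r) y =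
      deriv (deriv fun y => f y r) (x + y) - deriv (deriv fun y => f y r) (x - y) := by
  have hadd (z : ℝ) : HasDerivAt (fun z => x + z) 1 z := (hasDerivAt_id z).const_add x
  have hsub (z : ℝ) : HasDerivAt (fun z => x - z) (-1) z := (hasDerivAt_id z).const_sub x
  have h1 : (deriv fun y => f (x + y) r - f (x - y) r) = fun z =>
      deriv (fun y => f y r) (x + z) + deriv (fun y => f y r) (x - z) := by
    ext z
    have e₁ := ((h.differentiable hr (x + z)).hasDerivAt).comp z (hadd z)
    have e₂ := ((h.differentiable hr (x - z)).hasDerivAt).comp z (hsub z)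
    have := (e₁.sub e₂).deriv
    simp only [mul_one, mul_neg, sub_neg_eq_add] at this
    exact this
  rw [h1]
  have e₁ := ((h.differentiable_deriv hr (x + y)).hasDerivAt).comp y (hadd y)
  have e₂ := ((h.differentiable_deriv hr (x - y)).hasDerivAt).comp y (hsub y)
  have := (e₁.add e₂).deriv
  simp only [mul_one, mul_neg, ← sub_eq_add_neg] at this
  exact this

/-- Comparison principle on a rectangle with a barrier that is quadratic in space. -/
theorem le_barrier (h : IsClassicalOn f s t) {a x₁ x₂ α β : ℝ} (ha : 0 ≤ a) {θ θ' : ℝ → ℝ}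
    (hθc : ContinuousOn θ (Set.Icc s t)) (hθ : ∀ r ∈ Set.Ioc s t, HasDerivAt θ (θ' r) r)
    (hpde : ∀ x ∈ Set.Ioo x₁ x₂, ∀ r ∈ Set.Ioc s t,
      deriv (fun r => f x r) r - a * deriv (deriv fun y => f y r) x + 2 * a * β < θ' r)
    (hinit : ∀ x ∈ Set.Icc x₁ x₂, f x s ≤ θ s + α * x + β * x ^ 2)
    (hleft : ∀ r ∈ Set.Icc s t, f x₁ r ≤ θ r + α * x₁ + β * x₁ ^ 2)
    (hright : ∀ r ∈ Set.Icc s t, f x₂ r ≤ θ r + α * x₂ + β * x₂ ^ 2)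
    {x r : ℝ} (hx : x ∈ Set.Icc x₁ x₂) (hr : r ∈ Set.Icc s t) :
    f x r ≤ θ r + α * x + β * x ^ 2 := by
  set w : ℝ → ℝ → ℝ := fun x r => f x r - (θ r + α * x + β * x ^ 2) with hw
  have hwc : ContinuousOn (fun q : ℝ × ℝ => w q.1 q.2) (Set.Icc x₁ x₂ ×ˢ Set.Icc s t) := by
    refine (h.continuousOn.mono (Set.prod_mono_left (Set.subset_univ _))).sub ?_
    have : ContinuousOn (fun q : ℝ × ℝ => θ q.2) (Set.Icc x₁ x₂ ×ˢ Set.Icc s t) :=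
      hθc.comp continuousOn_snd (fun q hq => hq.2)
    exact (this.add (by fun_prop)).add (by fun_prop)
  obtain ⟨⟨y, q⟩, ⟨hy, hq⟩, hmax⟩ := (isCompact_Icc.prod isCompact_Icc).exists_isMaxOn
    ⟨(x, r), hx, hr⟩ hwc
  have hmax' (x' r' : ℝ) (hx' : x' ∈ Set.Icc x₁ x₂) (hr' : r' ∈ Set.Icc s t) :
      w x' r' ≤ w y q := hmax (a := (x', r')) ⟨hx', hr'⟩
  suffices hyq : w y q ≤ 0 by
    have := (hmax' x r hx hr).trans hyq
    simp only [hw] at this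
    linarith
  by_contra! hpos
  have hq' : q ∈ Set.Ioc s t := by
    refine ⟨lt_of_le_of_ne hq.1 ?_, hq.2⟩
    rintro rfl
    linarith [hinit y hy]
  have hy' : y ∈ Set.Ioo x₁ x₂ := by
    refine ⟨lt_of_le_of_ne hy.1 ?_, lt_of_le_of_ne hy.2 ?_⟩
    · rintro rfl
      linarith [hleft q hq]
    · rintro rfl
      linarith [hright q hq]
  have htime : θ' q ≤ deriv (fun r => f y r) q := by
    have hd : HasDerivAt (fun r => w y r) (deriv (fun r => f y r) q - θ' q) q :=
      (h.differentiableAt y q hq').hasDerivAt.sub (((hθ q hq').add_const _).add_const _)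
    have := hd.nonneg_of_forall_le_left hq'.1
      (fun r hr => hmax' y r hy ⟨hr.1, hr.2.trans hq.2⟩)
    linarith
  have hspace : deriv (deriv fun z => f z q) y ≤ 2 * β := by
    have hloc : IsLocalMax (fun z => w z q) y := by
      filter_upwards [Ioo_mem_nhds hy'.1 hy'.2] with z hz
      exact hmax' z q ⟨hz.1.le, hz.2.le⟩ hq
    have hquad (z : ℝ) : HasDerivAt (fun z => θ q + α * z + β * z ^ 2) (α + 2 * β * z) z := by
      refine ((((hasDerivAt_id z).const_mul α).const_add (θ q)).add
        ((hasDerivAt_pow 2 z).const_mul β)).congr_deriv ?_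
      norm_num
      ring
    have hd1 : (deriv fun z => w z q) = fun z => deriv (fun z => f z q) z - (α + 2 * β * z) := by
      ext z
      exact ((h.differentiable hq' z).hasDerivAt.sub (hquad z)).deriv
    have hlin : HasDerivAt (fun z => α + 2 * β * z) (2 * β) y := by
      simpa using ((hasDerivAt_id y).const_mul (2 * β)).const_add α
    have := hloc.deriv_deriv_nonpos
      ((h.differentiable hq' y).hasDerivAt.sub (hquad y)).continuousAt
    have hd2 := ((h.differentiable_deriv hq' y).hasDerivAt.sub hlin).deriv
    rw [hd1] at this
    exact sub_nonpos.1 (hd2 ▸ this)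
  have := hpde y hy' q hq'
  nlinarith

/-- Interior one-sided gradient bound for the inhomogeneous heat equation. -/
theorem deriv_le (h : IsClassicalOn f s t) {a S G : ℝ} (ha : 0 < a) (hS : 0 < S) (hst : s < t)
    (hbd : ∀ x, ∀ r ∈ Set.Icc s t, |f x r| ≤ S)
    (hpde : ∀ x, ∀ r ∈ Set.Ioc s t,
      |deriv (fun r => f x r) r - a * deriv (deriv fun y => f y r) x| ≤ G) (x : ℝ) :
    deriv (fun y => f y t) x ≤ S / √(t - s) * (1 + 1 / a) + G * √(t - s) / a := by
  have hℓ : 0 < t - s := sub_pos.2 hst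
  set L := √(t - s) with hL
  have hLpos : 0 < L := Real.sqrt_pos.2 hℓ
  have hLsq : t - s = L ^ 2 := (Real.sq_sqrt hℓ.le).symm
  have hG : 0 ≤ G := (abs_nonneg _).trans (hpde x t ⟨hst, le_rfl⟩)
  set κ := 2 * S / L ^ 2 with hκ
  have hκpos : 0 < κ := by positivity
  set β := (κ + 2 * G) / a with hβ
  have hβpos : 0 < β := by positivity
  have haβ : a * β = κ + 2 * G := by rw [hβ]; field_simp
  set α := 2 * S / L + β * L with hα
  have hαL : α * L = 2 * S + β * L ^ 2 := by rw [hα]; field_simp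
  have hκL : κ * L ^ 2 = 2 * S := by rw [hκ]; field_simp
  have hosc (y r : ℝ) (hr : r ∈ Set.Icc s t) : f (x + y) r - f (x - y) r ≤ 2 * S := by
    have h₁ := abs_le.1 (hbd (x + y) r hr)
    have h₂ := abs_le.1 (hbd (x - y) r hr)
    linarith
  have key (y : ℝ) (hy : y ∈ Set.Icc 0 L) : f (x + y) t - f (x - y) t ≤ α * y := by
    have := (h.sub_reflect x).le_barrier (a := a) (x₁ := 0) (x₂ := L) (α := α) (β := -β) ha.le
      (θ := fun r => κ * (t - r)) (θ' := fun _ => -κ) (by fun_prop)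
      (fun r _ => by simpa using ((hasDerivAt_id r).const_sub t).const_mul κ)
      (fun y _ r hr => by
        rw [h.deriv_deriv_sub_reflect hr]
        have hd : deriv (fun r => f (x + y) r - f (x - y) r) r =
            deriv (fun r => f (x + y) r) r - deriv (fun r => f (x - y) r) r :=
          ((h.differentiableAt _ r hr).hasDerivAt.sub (h.differentiableAt _ r hr).hasDerivAt).deriv
        rw [hd]
        have h₁ := abs_le.1 (hpde (x + y) r hr)
        have h₂ := abs_le.1 (hpde (x - y) r hr)
        nlinarith)
      (fun y hy => by
        have h₁ := hosc y s ⟨le_rfl, hst.le⟩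
        rw [hLsq, hκL]
        have : β * y ≤ α := by
          have : β * y ≤ β * L := mul_le_mul_of_nonneg_left hy.2 hβpos.le
          have : 0 ≤ 2 * S / L := by positivity
          linarith
        nlinarith [hy.1])
      (fun r hr => by
        have : 0 ≤ κ * (t - r) := mul_nonneg hκpos.le (sub_nonneg.2 hr.2)
        simpa using this)
      (fun r hr => by
        have : 0 ≤ κ * (t - r) := mul_nonneg hκpos.le (sub_nonneg.2 hr.2)
        have := hosc L r hr
        linarith)
      hy (Set.right_mem_Icc.2 hst.le)
    have h0 := mul_nonneg hβpos.le (sq_nonneg y)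
    simp only [sub_self, mul_zero, zero_add] at this
    linarith
  have hder : HasDerivAt (fun y => f (x + y) t - f (x - y) t)
      (2 * deriv (fun y => f y t) x) 0 := by
    have hd := (h.differentiable (r := t) ⟨hst, le_rfl⟩ x).hasDerivAt
    have e₁ := HasDerivAt.comp_const_add x 0 ((add_zero x).symm ▸ hd)
    have e₂ := HasDerivAt.comp_const_sub x 0 ((sub_zero x).symm ▸ hd)
    refine (e₁.sub e₂).congr_deriv ?_
    rw [add_zero, sub_zero]
    ring
  have h2 : 2 * deriv (fun y => f y t) x ≤ α := by
    refine le_of_tendsto (hasDerivAt_iff_tendsto_slope_left_right.1 hder).2 ?_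
    filter_upwards [Ioo_mem_nhdsGT hLpos] with y hy
    rw [slope_def_field]
    simp only [add_zero, sub_zero, sub_self]
    rw [div_le_iff₀ hy.1]
    exact key y ⟨hy.1.le, hy.2.le⟩
  have hαeq : α = 2 * (S / L * (1 + 1 / a) + G * L / a) := by
    rw [hα, hβ, hκ]
    field_simp
    ring
  linarith

/-- Interior gradient bound for the inhomogeneous heat equation. -/
theorem abs_deriv_le (h : IsClassicalOn f s t) {a S G : ℝ} (ha : 0 < a) (hS : 0 < S)
    (hst : s < t) (hbd : ∀ x, ∀ r ∈ Set.Icc s t, |f x r| ≤ S)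
    (hpde : ∀ x, ∀ r ∈ Set.Ioc s t,
      |deriv (fun r => f x r) r - a * deriv (deriv fun y => f y r) x| ≤ G) (x : ℝ) :
    |deriv (fun y => f y t) x| ≤ S / √(t - s) * (1 + 1 / a) + G * √(t - s) / a := by
  refine abs_le'.2 ⟨h.deriv_le ha hS hst hbd hpde x, ?_⟩
  have := h.neg.deriv_le ha hS hst (G := G) (fun x r hr => by simpa using hbd x r hr)
    (fun x r hr => by
      have hfun : (deriv fun y => -f y r) = fun y => -deriv (fun y => f y r) y := by
        ext y; exact deriv.fun_neg
      rw [hfun, deriv.fun_neg, deriv.fun_neg, ← abs_neg]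
      convert hpde x r hr using 2
      ring) x
  rwa [deriv.fun_neg] at this

/-- One-sided maximum principle for the inhomogeneous heat equation on the line, with a source
that may blow up like the inverse square root of time. -/
theorem le_of_source (h : IsClassicalOn f s t) {a S V m b : ℝ} (ha : 0 < a) (hm : 0 ≤ m)
    (hb : 0 ≤ b) (hV : 0 ≤ V) (hbd : ∀ x, ∀ r ∈ Set.Icc s t, f x r ≤ S) (hinit : ∀ x, f x s ≤ V)
    (hpde : ∀ x, ∀ r ∈ Set.Ioc s t,
      deriv (fun r => f x r) r - a * deriv (deriv fun y => f y r) x ≤ m / √(r - s) + b)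
    (x : ℝ) {r : ℝ} (hr : r ∈ Set.Icc s t) :
    f x r ≤ V + 2 * m * √(r - s) + b * (r - s) := by
  have key (ε : ℝ) (hε : 0 < ε) : f x r ≤
      V + 2 * m * √(r - s) + b * (r - s) + ε * ((2 * a + 1) * (r - s) + x ^ 2) := by
    set X := |x| + √(|S| / ε) with hX
    have hXx : |x| ≤ X := le_add_of_nonneg_right (Real.sqrt_nonneg _)
    have hSX : S ≤ ε * X ^ 2 := by
      have : |S| / ε ≤ X ^ 2 := by
        rw [← Real.sq_sqrt (div_nonneg (abs_nonneg S) hε.le)]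
        exact pow_le_pow_left₀ (Real.sqrt_nonneg _) (le_add_of_nonneg_left (abs_nonneg x)) 2
      rw [div_le_iff₀ hε] at this
      linarith [le_abs_self S]
    set θ : ℝ → ℝ := fun r => V + 2 * m * √(r - s) + (b + ε * (2 * a + 1)) * (r - s) with hθ
    have hθ0 (r : ℝ) (hr : r ∈ Set.Icc s t) : 0 ≤ θ r := by
      have := sub_nonneg.2 hr.1
      positivity
    have := h.le_barrier (x₁ := -X) (x₂ := X) (α := 0) (β := ε) ha.le (θ := θ)
      (θ' := fun r => m / √(r - s) + (b + ε * (2 * a + 1))) (by fun_prop)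
      (fun r hr => by
        have hrs : r - s ≠ 0 := (sub_pos.2 hr.1).ne'
        have e₁ := ((((hasDerivAt_id r).sub_const s).sqrt hrs).const_mul (2 * m)).const_add V
        have e₂ := ((hasDerivAt_id r).sub_const s).const_mul (b + ε * (2 * a + 1))
        refine (e₁.add e₂).congr_deriv ?_
        simp only [id]
        field_simp)
      (fun x _ r hr => by
        have := hpde x r hr
        linarith)
      (fun x _ => by
        have := hinit x
        have := mul_nonneg hε.le (sq_nonneg x)
        simp only [hθ, sub_self, Real.sqrt_zero]
        linarith)
      (fun r hr => by
        have := hbd (-X) r hr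
        have := hθ0 r hr
        rw [neg_sq]
        linarith)
      (fun r hr => by
        have := hbd X r hr
        have := hθ0 r hr
        linarith)
      (abs_le.1 hXx) hr
    simp only [hθ] at this
    linarith
  have hlim : Tendsto (fun ε : ℝ => V + 2 * m * √(r - s) + b * (r - s) +
      ε * ((2 * a + 1) * (r - s) + x ^ 2)) (𝓝[>] 0)
      (𝓝 (V + 2 * m * √(r - s) + b * (r - s))) := by
    refine Tendsto.mono_left ?_ nhdsWithin_le_nhds
    have hc : Continuous (fun ε : ℝ => V + 2 * m * √(r - s) + b * (r - s) +
      ε * ((2 * a + 1) * (r - s) + x ^ 2)) := by fun_prop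
    simpa using hc.tendsto 0
  exact ge_of_tendsto hlim (by filter_upwards [self_mem_nhdsWithin] with ε hε using key ε hε)

/-- Maximum principle for the inhomogeneous heat equation on the line, with a source
that may blow up like the inverse square root of time. -/
theorem abs_le_of_source (h : IsClassicalOn f s t) {a S V m b : ℝ} (ha : 0 < a) (hm : 0 ≤ m)
    (hb : 0 ≤ b) (hbd : ∀ x, ∀ r ∈ Set.Icc s t, |f x r| ≤ S) (hinit : ∀ x, |f x s| ≤ V)
    (hpde : ∀ x, ∀ r ∈ Set.Ioc s t,
      |deriv (fun r => f x r) r - a * deriv (deriv fun y => f y r) x| ≤ m / √(r - s) + b)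
    (x : ℝ) {r : ℝ} (hr : r ∈ Set.Icc s t) :
    |f x r| ≤ V + 2 * m * √(r - s) + b * (r - s) := by
  have hV : 0 ≤ V := (abs_nonneg _).trans (hinit x)
  refine abs_le'.2 ⟨?_, ?_⟩
  · exact h.le_of_source ha hm hb hV (fun x r hr => (le_abs_self _).trans (hbd x r hr))
      (fun x => (le_abs_self _).trans (hinit x))
      (fun x r hr => (le_abs_self _).trans (hpde x r hr)) x hr
  · refine h.neg.le_of_source ha hm hb hV (fun x r hr => (neg_le_abs _).trans (hbd x r hr))
      (fun x => (neg_le_abs _).trans (hinit x)) (fun x r hr => ?_) x hr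
    have hfun : (deriv fun y => -f y r) = fun y => -deriv (fun y => f y r) y := by
      ext y; exact deriv.fun_neg
    rw [hfun, deriv.fun_neg, deriv.fun_neg]
    linarith [(abs_le.1 (hpde x r hr)).1]

end IsClassicalOn

section System

variable {N : ℕ}

/-- Classical solutions on `(0, T]` of `v_t = A v_xx + C(x) v_x + B(x) v`. -/
structure IsClassicalSolution (A : Matrix (Fin N) (Fin N) ℝ) (B C : ℝ → Matrix (Fin N) (Fin N) ℝ)
    (T : ℝ) (v : ℝ → ℝ → Fin N → ℝ) : Prop where
  continuousOn : ContinuousOn (fun q : ℝ × ℝ => v q.1 q.2) (Set.univ ×ˢ Set.Icc 0 T)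
  differentiableAt : ∀ x, ∀ t ∈ Set.Ioc 0 T, DifferentiableAt ℝ (fun s => v x s) t
  contDiff : ∀ t ∈ Set.Ioc 0 T, ContDiff ℝ 2 (fun y => v y t)
  deriv_eq : ∀ x, ∀ t ∈ Set.Ioc 0 T, deriv (fun s => v x s) t =
    A.mulVec (deriv (deriv (fun y => v y t)) x) + (C x).mulVec (deriv (fun y => v y t) x)
      + (B x).mulVec (v x t)

theorem Matrix.abs_mulVec_le {M : Matrix (Fin N) (Fin N) ℝ} {R : ℝ} (hM : ∀ i j, |M i j| ≤ R)
    (w : Fin N → ℝ) (i : Fin N) : |M.mulVec w i| ≤ N * R * ‖w‖ := by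
  simp only [Matrix.mulVec, dotProduct]
  calc |∑ j, M i j * w j| ≤ ∑ j, |M i j * w j| := Finset.abs_sum_le_sum_abs _ _
    _ ≤ ∑ _j : Fin N, R * ‖w‖ := by
        refine Finset.sum_le_sum fun j _ => ?_
        rw [abs_mul]
        exact mul_le_mul (hM i j) (norm_le_pi_norm w j) (abs_nonneg _)
          ((abs_nonneg _).trans (hM i j))
    _ = N * R * ‖w‖ := by simp [mul_assoc]

theorem Matrix.mulVec_apply_of_offDiag_eq_zero {A : Matrix (Fin N) (Fin N) ℝ}
    (hA : ∀ i j, i ≠ j → A i j = 0) (w : Fin N → ℝ) (i : Fin N) :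
    A.mulVec w i = A i i * w i := by
  simp only [Matrix.mulVec, dotProduct]
  exact Finset.sum_eq_single i (fun j _ hj => by rw [hA i j hj.symm, zero_mul]) (by simp)

theorem deriv_apply_eq {g : ℝ → Fin N → ℝ} {x : ℝ} (hg : DifferentiableAt ℝ g x) (i : Fin N) :
    deriv (fun y => g y i) x = deriv g x i :=
  (hasDerivAt_pi.1 hg.hasDerivAt i).deriv

namespace IsClassicalSolution

variable {A : Matrix (Fin N) (Fin N) ℝ} {B C : ℝ → Matrix (Fin N) (Fin N) ℝ} {T : ℝ}
  {v : ℝ → ℝ → Fin N → ℝ}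

theorem isClassicalOn (h : IsClassicalSolution A B C T v) (i : Fin N) :
    IsClassicalOn (fun x t => v x t i) 0 T where
  continuousOn := continuousOn_pi.1 h.continuousOn i
  differentiableAt x t ht := differentiableAt_pi.1 (h.differentiableAt x t ht) i
  contDiff t ht := contDiff_pi.1 (h.contDiff t ht) i

theorem deriv_apply (h : IsClassicalSolution A B C T v) {t : ℝ} (ht : t ∈ Set.Ioc 0 T) (x : ℝ)
    (i : Fin N) : deriv (fun y => v y t i) x = deriv (fun y => v y t) x i :=
  deriv_apply_eq (g := fun y => v y t) ((h.contDiff t ht).differentiable (by norm_num) x) i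

theorem deriv_deriv_apply (h : IsClassicalSolution A B C T v) {t : ℝ} (ht : t ∈ Set.Ioc 0 T)
    (x : ℝ) (i : Fin N) :
    deriv (deriv fun y => v y t i) x = deriv (deriv fun y => v y t) x i := by
  rw [funext fun x => h.deriv_apply ht x i]
  exact deriv_apply_eq
    (((contDiff_succ_iff_deriv (n := 1)).1 (h.contDiff t ht)).2.2.differentiable (by norm_num) x) i

/-- Each component solves a scalar heat equation whose source is controlled by the solution
and its gradient. -/
theorem abs_source_le (h : IsClassicalSolution A B C T v) (hA : ∀ i j, i ≠ j → A i j = 0) {R : ℝ}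
    (hB : ∀ x i j, |B x i j| ≤ R) (hC : ∀ x i j, |C x i j| ≤ R) (i : Fin N) (x : ℝ) {t : ℝ}
    (ht : t ∈ Set.Ioc 0 T) :
    |deriv (fun s => v x s i) t - A i i * deriv (deriv fun y => v y t i) x| ≤
      N * R * (‖deriv (fun y => v y t) x‖ + ‖v x t‖) := by
  rw [h.deriv_deriv_apply ht, deriv_apply_eq (g := fun s => v x s) (h.differentiableAt x t ht) i,
    h.deriv_eq x t ht, Pi.add_apply, Pi.add_apply, Matrix.mulVec_apply_of_offDiag_eq_zero hA]
  rw [mul_add, add_assoc, add_sub_cancel_left]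
  exact (abs_add_le _ _).trans
    (add_le_add (Matrix.abs_mulVec_le (hC x) _ i) (Matrix.abs_mulVec_le (hB x) _ i))

/-- On a short time window, the norm `‖v‖ + √t ‖v_x‖` is controlled by the initial data and half
of itself. -/
theorem norm_le_add_half (h : IsClassicalSolution A B C T v) (hA : ∀ i j, i ≠ j → A i j = 0)
    (hApos : ∀ i, 0 < A i i) {R : ℝ} (hR : 0 ≤ R)
    (hB : ∀ x i j, |B x i j| ≤ R) (hC : ∀ x i j, |C x i j| ≤ R) {k r s t₁ V P : ℝ} (hk : 1 ≤ k)
    (hAk : ∀ i, 1 + 1 / A i i ≤ k) (hr0 : 0 ≤ r) (hr1 : r ≤ 1) (hr : 40 * (N * R * k * r) ≤ 1)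
    (hs : 0 ≤ s) (ht₁T : t₁ ≤ T) (ht₁ : t₁ ≤ s + r ^ 2) (hV : 0 ≤ V) (hP : 0 < P)
    (hinit : ∀ x, ‖v x s‖ ≤ V)
    (hbd : ∀ x, ∀ t ∈ Set.Icc s t₁,
      ‖v x t‖ ≤ P ∧ √(t - s) * ‖deriv (fun y => v y t) x‖ ≤ 8 * k * P) :
    ∀ x, ∀ t ∈ Set.Icc s t₁,
      ‖v x t‖ ≤ V + P / 2 ∧ √(t - s) * ‖deriv (fun y => v y t) x‖ ≤ 8 * k * (V + P / 2) := by
  intro x t ht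
  have hk0 : 0 < k := by linarith
  set Q : ℝ := N * R with hQ
  have hQ0 : 0 ≤ Q := by positivity
  have hsqrt (t' : ℝ) (ht' : t' ≤ s + r ^ 2) : √(t' - s) ≤ r :=
    Real.sqrt_le_iff.2 ⟨hr0, by linarith⟩
  have hgrad (x t' : ℝ) (ht' : t' ∈ Set.Ioc s t₁) :
      ‖deriv (fun y => v y t') x‖ ≤ 8 * k * P / √(t' - s) := by
    rw [le_div_iff₀ (Real.sqrt_pos.2 (sub_pos.2 ht'.1)), mul_comm]
    exact (hbd x t' (Set.Ioc_subset_Icc_self ht')).2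
  have hsmall (q : ℝ) (hq : q ≤ r) : Q * k * q ≤ 1 / 40 := by
    have := mul_le_mul_of_nonneg_left hq (mul_nonneg hQ0 hk0.le)
    linarith
  constructor
  · refine (pi_norm_le_iff_of_nonneg (by positivity)).2 fun i => ?_
    have hsrc := ((h.isClassicalOn i).mono hs ht₁T).abs_le_of_source (hApos i)
      (S := P) (V := V) (m := Q * (8 * k * P)) (b := Q * P) (by positivity) (by positivity)
      (fun x t ht => (norm_le_pi_norm _ i).trans (hbd x t ht).1)
      (fun x => (norm_le_pi_norm _ i).trans (hinit x))
      (fun x t ht => by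
        refine (h.abs_source_le hA hB hC i x ⟨hs.trans_lt ht.1, ht.2.trans ht₁T⟩).trans ?_
        rw [mul_div_assoc, ← mul_add]
        exact mul_le_mul_of_nonneg_left
          (add_le_add (hgrad x t ht) (hbd x t (Set.Ioc_subset_Icc_self ht)).1) hQ0)
      x ht
    refine hsrc.trans ?_
    have hts : t - s = √(t - s) ^ 2 := (Real.sq_sqrt (sub_nonneg.2 ht.1)).symm
    have hq : √(t - s) ≤ r := hsqrt t (ht.2.trans ht₁)
    have hq0 := Real.sqrt_nonneg (t - s)
    set q := √(t - s)
    rw [hts]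
    have hQkq := hsmall q hq
    have h₁ : Q * q ^ 2 ≤ Q * k * q := by
      have : q * q ≤ k * q := mul_le_mul_of_nonneg_right (by linarith) hq0
      nlinarith
    nlinarith
  · rcases eq_or_lt_of_le ht.1 with rfl | hst
    · simp only [sub_self, Real.sqrt_zero, zero_mul]
      positivity
    set c := (s + t) / 2 with hc
    have hsc : s < c := by linarith
    have hct : c < t := by linarith
    have hts : √(t - s) ≤ 2 * √(t - c) := by
      refine Real.sqrt_le_iff.2 ⟨by positivity, ?_⟩
      rw [mul_pow, Real.sq_sqrt (by linarith)]
      linarith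
    have hq0 : 0 < √(t - c) := Real.sqrt_pos.2 (by linarith)
    have hqr : √(t - c) ≤ r := (Real.sqrt_le_sqrt (by linarith)).trans (hsqrt t (ht.2.trans ht₁))
    have hmono (t' : ℝ) (ht' : c < t') : √(t - c) ≤ √(t' - s) :=
      Real.sqrt_le_sqrt (by linarith)
    set q := √(t - c)
    have hder : ‖deriv (fun y => v y t) x‖ ≤ P / q * k + Q * (8 * k * P / q + P) * q * k := by
      refine (pi_norm_le_iff_of_nonneg (by positivity)).2 fun i => ?_
      rw [← h.deriv_apply ⟨hs.trans_lt hst, ht.2.trans ht₁T⟩]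
      have hsrc := ((h.isClassicalOn i).mono (hs.trans hsc.le) (ht.2.trans ht₁T)).abs_deriv_le
        (hApos i) hP hct (G := Q * (8 * k * P / q + P))
        (fun x t' ht' => (norm_le_pi_norm _ i).trans
          (hbd x t' ⟨hsc.le.trans ht'.1, ht'.2.trans ht.2⟩).1)
        (fun x t' ht' => by
          have ht'' : t' ∈ Set.Ioc s t₁ := ⟨hsc.trans ht'.1, ht'.2.trans ht.2⟩
          refine (h.abs_source_le hA hB hC i x ⟨hs.trans_lt ht''.1, ht''.2.trans ht₁T⟩).trans ?_
          refine mul_le_mul_of_nonneg_left (add_le_add ((hgrad x t' ht'').trans ?_)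
            (hbd x t' (Set.Ioc_subset_Icc_self ht'')).1) hQ0
          exact div_le_div_of_nonneg_left (by positivity) hq0 (hmono t' ht'.1))
        x
      refine hsrc.trans (add_le_add ?_ ?_)
      · exact mul_le_mul_of_nonneg_left (hAk i) (by positivity)
      · rw [div_eq_mul_one_div _ (A i i)]
        exact mul_le_mul_of_nonneg_left (by linarith [hAk i]) (by positivity)
    have hQkq := hsmall q hqr
    calc √(t - s) * ‖deriv (fun y => v y t) x‖
        ≤ 2 * q * (P / q * k + Q * (8 * k * P / q + P) * q * k) :=
          mul_le_mul hts hder (norm_nonneg _) (by positivity)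
      _ = 2 * k * P + 2 * (Q * k * q) * (8 * k + q) * P := by field_simp
      _ ≤ 2 * k * P + 2 * (1 / 40) * (9 * k) * P := by
          gcongr
          linarith
      _ ≤ 8 * k * (V + P / 2) := by nlinarith [mul_pos hk0 hP, mul_nonneg hk0.le hV]

/-- Smoothing estimate on a short time window. -/
theorem norm_le_two_mul (h : IsClassicalSolution A B C T v) (hA : ∀ i j, i ≠ j → A i j = 0)
    (hApos : ∀ i, 0 < A i i) {R : ℝ} (hR : 0 ≤ R)
    (hB : ∀ x i j, |B x i j| ≤ R) (hC : ∀ x i j, |C x i j| ≤ R)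
    (hbd : ∃ M, ∀ x, ∀ t ∈ Set.Icc 0 T, ‖v x t‖ ≤ M ∧ ‖deriv (fun y => v y t) x‖ ≤ M)
    {k r s V : ℝ} (hk : 1 ≤ k)
    (hAk : ∀ i, 1 + 1 / A i i ≤ k) (hr0 : 0 ≤ r) (hr1 : r ≤ 1) (hr : 40 * (N * R * k * r) ≤ 1)
    (hs : 0 ≤ s) (hinit : ∀ x, ‖v x s‖ ≤ V) (x : ℝ) {t : ℝ} (hst : s ≤ t) (htT : t ≤ T)
    (htr : t ≤ s + r ^ 2) :
    ‖v x t‖ ≤ 2 * V ∧ √(t - s) * ‖deriv (fun y => v y t) x‖ ≤ 16 * k * V := by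
  obtain ⟨M, hM⟩ := hbd
  have hV : 0 ≤ V := (norm_nonneg _).trans (hinit x)
  have hk0 : 0 < k := by linarith
  have key (n : ℕ) : ∀ x, ∀ t' ∈ Set.Icc s t, ‖v x t'‖ ≤ 2 * V + (|M| + 1) / 2 ^ n ∧
      √(t' - s) * ‖deriv (fun y => v y t') x‖ ≤ 8 * k * (2 * V + (|M| + 1) / 2 ^ n) := by
    induction n with
    | zero =>
      intro x t' ht'
      obtain ⟨h₁, h₂⟩ := hM x t' ⟨hs.trans ht'.1, ht'.2.trans htT⟩
      have hMM := le_abs_self M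
      rw [pow_zero, div_one]
      refine ⟨by linarith, ?_⟩
      have hsq : √(t' - s) ≤ 1 :=
        (Real.sqrt_le_iff.2 ⟨hr0, by linarith [ht'.2]⟩ : √(t' - s) ≤ r).trans hr1
      calc √(t' - s) * ‖deriv (fun y => v y t') x‖ ≤ 1 * (2 * V + (|M| + 1)) :=
            mul_le_mul hsq (by linarith) (norm_nonneg _) zero_le_one
        _ ≤ 8 * k * (2 * V + (|M| + 1)) :=
            mul_le_mul_of_nonneg_right (by linarith) (by positivity)
    | succ n ih =>
      have := h.norm_le_add_half hA hApos hR hB hC hk hAk hr0 hr1 hr hs htT htr hV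
        (by positivity) hinit ih
      have heq : V + (2 * V + (|M| + 1) / 2 ^ n) / 2 = 2 * V + (|M| + 1) / 2 ^ (n + 1) := by
        rw [pow_succ]
        ring
      rwa [heq] at this
  have hlim : Tendsto (fun n : ℕ => 2 * V + (|M| + 1) / 2 ^ n) atTop (𝓝 (2 * V)) := by
    have := (tendsto_pow_atTop_nhds_zero_of_lt_one (r := (1 / 2 : ℝ)) (by norm_num)
      (by norm_num)).const_mul (|M| + 1) |>.const_add (2 * V)
    simpa [div_eq_mul_inv] using this
  refine ⟨ge_of_tendsto' hlim fun n => (key n x t ⟨hst, le_rfl⟩).1, ?_⟩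
  have := ge_of_tendsto' (hlim.const_mul (8 * k)) fun n => (key n x t ⟨hst, le_rfl⟩).2
  linarith

/-- Exponential growth bound for bounded classical solutions. -/
theorem norm_le_two_pow_mul (h : IsClassicalSolution A B C T v) (hA : ∀ i j, i ≠ j → A i j = 0)
    (hApos : ∀ i, 0 < A i i) {R : ℝ} (hR : 0 ≤ R)
    (hB : ∀ x i j, |B x i j| ≤ R) (hC : ∀ x i j, |C x i j| ≤ R)
    (hbd : ∃ M, ∀ x, ∀ t ∈ Set.Icc 0 T, ‖v x t‖ ≤ M ∧ ‖deriv (fun y => v y t) x‖ ≤ M)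
    {k r V : ℝ} (hk : 1 ≤ k)
    (hAk : ∀ i, 1 + 1 / A i i ≤ k) (hr0 : 0 ≤ r) (hr1 : r ≤ 1) (hr : 40 * (N * R * k * r) ≤ 1)
    (hinit : ∀ x, ‖v x 0‖ ≤ V) (n : ℕ) (x : ℝ) {t : ℝ} (ht : t ∈ Set.Icc 0 T)
    (htn : t ≤ n * r ^ 2) : ‖v x t‖ ≤ 2 ^ n * V := by
  induction n generalizing x t with
  | zero =>
    obtain rfl : t = 0 := le_antisymm (by simpa using htn) ht.1
    simpa using hinit x
  | succ n ih =>
    have hV : 0 ≤ V := (norm_nonneg _).trans (hinit x)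
    rcases le_total t (n * r ^ 2) with htn' | htn'
    · refine (ih x ht htn').trans (mul_le_mul_of_nonneg_right ?_ hV)
      exact pow_le_pow_right₀ one_le_two n.le_succ
    · have hs0 : 0 ≤ n * r ^ 2 := by positivity
      have := (h.norm_le_two_mul hA hApos hR hB hC hbd hk hAk hr0 hr1 hr hs0
        (fun y => ih y ⟨hs0, htn'.trans ht.2⟩ le_rfl) x htn' ht.2
        (by push_cast at htn; linarith)).1
      rwa [pow_succ', mul_assoc]

end IsClassicalSolution

end System

/-- parabolic smoothing for the linear system
v_t = A v_xx + C(x) v_x + B(x) v: there is a constant M > 0 depending only on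
A and the sup-norms of B and C such that any bounded classical solution with
bounded continuous initial datum v₀ satisfies
sup_x |v_x(x,t)| ≤ M t^{-1/2} e^{M t} sup_x |v₀(x)| for t ∈ (0,T]. -/
theorem parabolic_smoothing_gradient_estimate
    (N : ℕ) (hN : 1 ≤ N)
    (A : Matrix (Fin N) (Fin N) ℝ)
    (hAdiag : ∀ i j, i ≠ j → A i j = 0) (hApos : ∀ i, 0 < A i i)
    (R : ℝ) (hR : 0 < R) :
    ∃ M > (0 : ℝ),
      ∀ B C : ℝ → Matrix (Fin N) (Fin N) ℝ,
        (∀ i j, Continuous fun x => B x i j) →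
        (∀ i j, Continuous fun x => C x i j) →
        (∀ x i j, |B x i j| ≤ R) → (∀ x i j, |C x i j| ≤ R) →
        ∀ T > (0 : ℝ), ∀ v : ℝ → ℝ → Fin N → ℝ, ∀ v₀ : ℝ → Fin N → ℝ,
          Continuous v₀ → (∃ M', ∀ x, ‖v₀ x‖ ≤ M') →
          (∀ x, v x 0 = v₀ x) →
          ContinuousOn (fun q : ℝ × ℝ => v q.1 q.2) (Set.univ ×ˢ Set.Icc 0 T) →
          (∃ M', ∀ x : ℝ, ∀ t ∈ Set.Icc (0 : ℝ) T,
            ‖v x t‖ ≤ M' ∧ ‖deriv (fun y => v y t) x‖ ≤ M') →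
          (∀ x : ℝ, ∀ t ∈ Set.Ioc (0 : ℝ) T,
            DifferentiableAt ℝ (fun s => v x s) t) →
          (∀ t ∈ Set.Ioc (0 : ℝ) T, ContDiff ℝ 2 (fun y => v y t)) →
          (∀ x : ℝ, ∀ t ∈ Set.Ioc (0 : ℝ) T, deriv (fun s => v x s) t =
            A.mulVec (deriv (deriv (fun y => v y t)) x)
              + (C x).mulVec (deriv (fun y => v y t) x)
              + (B x).mulVec (v x t)) →
          ∀ t ∈ Set.Ioc (0 : ℝ) T, ∀ x : ℝ,
            ‖deriv (fun y => v y t) x‖ ≤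
              M * (Real.sqrt t)⁻¹ * Real.exp (M * t) * ⨆ y : ℝ, ‖v₀ y‖ := by
  have hsum : 0 ≤ ∑ i, 1 / A i i := Finset.sum_nonneg fun i _ => (one_div_pos.2 (hApos i)).le
  set k : ℝ := 1 + ∑ i, 1 / A i i with hkdef
  have hk : 1 ≤ k := by linarith
  have hAk (i : Fin N) : 1 + 1 / A i i ≤ k := by
    have := Finset.single_le_sum (f := fun i => 1 / A i i)
      (fun i _ => (one_div_pos.2 (hApos i)).le) (Finset.mem_univ i)
    linarith
  have hQ : 0 ≤ N * R * k := by positivity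
  set r : ℝ := 1 / (40 * (N * R * k) + 1) with hrdef
  have hr0 : 0 < r := by positivity
  have hr1 : r ≤ 1 := (div_le_one (by positivity)).2 (by linarith)
  have hr : 40 * (N * R * k * r) ≤ 1 := by
    rw [hrdef, ← mul_assoc, mul_one_div]
    exact (div_le_one (by positivity)).2 (by linarith)
  refine ⟨16 * k + 2 / r ^ 2, by positivity, ?_⟩
  intro B C _ _ hB hC T _ v v₀ _ hv₀ hinit hcont hbd hdt hdx hpde t ht x
  have h : IsClassicalSolution A B C T v := ⟨hcont, hdt, hdx, hpde⟩
  set V := ⨆ y : ℝ, ‖v₀ y‖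
  have hV (y : ℝ) : ‖v y 0‖ ≤ V := by
    obtain ⟨M', hM'⟩ := hv₀
    rw [hinit]
    exact le_ciSup (f := fun y => ‖v₀ y‖) ⟨M', by rintro _ ⟨y, rfl⟩; exact hM' y⟩ y
  have hV0 : 0 ≤ V := (norm_nonneg _).trans (hV 0)
  have hsqrt : 0 < √t := Real.sqrt_pos.2 ht.1
  have hratio : 0 ≤ t / r ^ 2 := div_nonneg ht.1.le (by positivity)
  suffices hmain : √t * ‖deriv (fun y => v y t) x‖ ≤
      16 * k * (Real.exp (t / r ^ 2) * Real.exp (t / r ^ 2)) * V by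
    have hconst : 16 * k * (Real.exp (t / r ^ 2) * Real.exp (t / r ^ 2)) ≤
        (16 * k + 2 / r ^ 2) * Real.exp ((16 * k + 2 / r ^ 2) * t) := by
      rw [← Real.exp_add]
      have h2 : (0 : ℝ) ≤ 2 / r ^ 2 := by positivity
      have h3 : 0 ≤ 16 * k * t := mul_nonneg (by positivity) ht.1.le
      refine mul_le_mul (by linarith) (Real.exp_le_exp.2 ?_) (Real.exp_nonneg _) (by positivity)
      have : t / r ^ 2 + t / r ^ 2 = 2 / r ^ 2 * t := by ring
      linarith
    have hfin := hmain.trans (mul_le_mul_of_nonneg_right hconst hV0)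
    rw [mul_comm, ← le_div_iff₀ hsqrt] at hfin
    refine hfin.trans_eq ?_
    ring
  have hexp1 : 1 ≤ Real.exp (t / r ^ 2) := Real.one_le_exp hratio
  rcases le_total t (r ^ 2) with htr | htr
  · have := (h.norm_le_two_mul hAdiag hApos hR.le hB hC hbd hk hAk hr0.le hr1 hr le_rfl hV x
      ht.1.le ht.2 (by linarith)).2
    rw [sub_zero] at this
    refine this.trans (mul_le_mul_of_nonneg_right ?_ hV0)
    exact le_mul_of_one_le_right (by positivity) (by nlinarith)
  · have hs0 : 0 ≤ t - r ^ 2 := sub_nonneg.2 htr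
    have hr2 : 0 < r ^ 2 := by positivity
    set n := ⌈(t - r ^ 2) / r ^ 2⌉₊
    have hn1 : t - r ^ 2 ≤ n * r ^ 2 := (div_le_iff₀ hr2).1 (Nat.le_ceil _)
    have hn2 : (n : ℝ) ≤ t / r ^ 2 := by
      have := (Nat.ceil_lt_add_one (div_nonneg hs0 hr2.le)).le
      have heq : (t - r ^ 2) / r ^ 2 + 1 = t / r ^ 2 := by field_simp; ring
      exact this.trans_eq heq
    have hpow : (2 : ℝ) ^ n ≤ Real.exp (t / r ^ 2) := by
      have h2 : (2 : ℝ) ≤ Real.exp 1 := by linarith [Real.add_one_le_exp (1 : ℝ)]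
      calc (2 : ℝ) ^ n ≤ Real.exp 1 ^ n := pow_le_pow_left₀ zero_le_two h2 n
        _ = Real.exp n := by rw [← Real.exp_nat_mul, mul_one]
        _ ≤ _ := Real.exp_le_exp.2 hn2
    have hbase (y : ℝ) : ‖v y (t - r ^ 2)‖ ≤ Real.exp (t / r ^ 2) * V :=
      (h.norm_le_two_pow_mul hAdiag hApos hR.le hB hC hbd hk hAk hr0.le hr1 hr hV n y
        ⟨hs0, by linarith [ht.2]⟩ hn1).trans (mul_le_mul_of_nonneg_right hpow hV0)
    have hgrad := (h.norm_le_two_mul hAdiag hApos hR.le hB hC hbd hk hAk hr0.le hr1 hr hs0 hbase x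
      (by linarith) ht.2 (by linarith)).2
    rw [sub_sub_cancel, Real.sqrt_sq hr0.le] at hgrad
    have hroot : √t ≤ Real.exp (t / r ^ 2) * r := by
      have : √(t / r ^ 2) ≤ Real.exp (t / r ^ 2) := by
        refine Real.sqrt_le_iff.2 ⟨Real.exp_nonneg _, ?_⟩
        nlinarith [Real.add_one_le_exp (t / r ^ 2)]
      rwa [Real.sqrt_div ht.1.le, Real.sqrt_sq hr0.le, div_le_iff₀ hr0] at this
    calc √t * ‖deriv (fun y => v y t) x‖
        ≤ Real.exp (t / r ^ 2) * r * ‖deriv (fun y => v y t) x‖ :=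
          mul_le_mul_of_nonneg_right hroot (norm_nonneg _)
      _ = Real.exp (t / r ^ 2) * (r * ‖deriv (fun y => v y t) x‖) := by ring
      _ ≤ Real.exp (t / r ^ 2) * (16 * k * (Real.exp (t / r ^ 2) * V)) :=
          mul_le_mul_of_nonneg_left hgrad (Real.exp_nonneg _)
      _ = _ := by ring
end
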